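/- arXiv:1405.1278 — 5 statements merged into one kernel-verified Lean document; each statement's English description precedes it below -/
import Mathlib

section
/- Let Λ be a ring, (e, f) a pair of complementary idempotents (f = 1 − e), and Λ* = fΛf. Suppose the left Λ*-module fΛe has projective dimension c < ∞. Let X be a left Λ-module with a projective resolution having n-th syzygy Ω^n_Λ(X), and let Ω^n_{Λ*}(F(X)) denote the n-th syzygy of F(X) = fΛ ⊗_Λ X in a projective Λ*-resolution. Then for all t > c + 1 and all n ≥ 0, the functors Ext^t_{Λ*}(F(Ω^n_Λ(X)), −) and Ext^t_{Λ*}(Ω^n_{Λ*}(F(X)), −) are naturally isomorphic. -/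
/-! STATEMENT 10: Let `(e, f)` be complementary idempotents in `Λ`, `Λ* = fΛf`, and
suppose `pd_{Λ*}(fΛe) = c < ∞` (encoded by vanishing of `Ext^k` for `k > c`).  For a
`Λ`-module `X` with a projective resolution having syzygies `Ωⁿ_Λ(X)`, and a projective
`Λ*`-resolution of `F(X) = fΛ ⊗_Λ X` (realized as `fX = CornerSub f X`) with syzygies
`Ωⁿ_{Λ*}(F X)`, for all `t > c + 1` and `n ≥ 0` the functors `Ext^t_{Λ*}(F(Ωⁿ_Λ X), -)`
and `Ext^t_{Λ*}(Ωⁿ_{Λ*}(F X), -)` are naturally isomorphic. -/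

universe u

section CornerLib

variable {Λ : Type u} [Ring Λ]

/-- The set `{x | f * x * f = x}`, i.e. the corner `fΛf`, as an additive subgroup. -/
def cornerAddSubgroup (f : Λ) : AddSubgroup Λ where
  carrier := {x | f * x * f = x}
  add_mem' := by
    intro a b ha hb
    simp only [Set.mem_setOf_eq] at *
    rw [mul_add, add_mul, ha, hb]
  zero_mem' := by simp
  neg_mem' := by
    intro a ha
    simp only [Set.mem_setOf_eq] at *
    rw [mul_neg, neg_mul, ha]

/-- The corner ring `fΛf`. -/
def Corner (f : Λ) : Type u := ↥(cornerAddSubgroup f)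

instance (e : Λ) [he : Fact (IsIdempotentElem e)] : Fact (IsIdempotentElem (1 - e)) :=
  ⟨he.out.one_sub⟩

namespace Corner

variable {f : Λ} [hf : Fact (IsIdempotentElem f)]

instance : AddCommGroup (Corner f) :=
  inferInstanceAs (AddCommGroup ↥(cornerAddSubgroup f))

theorem absorb_left {x : Λ} (hx : f * x * f = x) : f * x = x := by
  conv_lhs => rw [← hx]
  rw [← mul_assoc, ← mul_assoc, hf.out]
  exact hx

theorem absorb_right {x : Λ} (hx : f * x * f = x) : x * f = x := by
  conv_lhs => rw [← hx]
  rw [mul_assoc, mul_assoc, hf.out]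
  rw [← mul_assoc]
  exact hx

theorem mul_mem' {x y : Λ} (hx : f * x * f = x) (hy : f * y * f = y) :
    f * (x * y) * f = x * y := by
  rw [← mul_assoc f x y, absorb_left hx, mul_assoc, absorb_right hy]

instance : Ring (Corner f) :=
  { (inferInstance : AddCommGroup (Corner f)) with
    mul := fun x y => ⟨x.1 * y.1, mul_mem' x.2 y.2⟩
    one := ⟨f, by show f * f * f = f; rw [hf.out, hf.out]⟩
    mul_assoc := fun a b c => Subtype.ext (mul_assoc a.1 b.1 c.1)
    one_mul := fun a => Subtype.ext (absorb_left a.2)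
    mul_one := fun a => Subtype.ext (absorb_right a.2)
    left_distrib := fun a b c => Subtype.ext (mul_add a.1 b.1 c.1)
    right_distrib := fun a b c => Subtype.ext (add_mul a.1 b.1 c.1)
    zero_mul := fun a => Subtype.ext (zero_mul a.1)
    mul_zero := fun a => Subtype.ext (mul_zero a.1) }

@[simp] theorem mul_val (x y : Corner f) : (x * y).1 = x.1 * y.1 := rfl
@[simp] theorem one_val : (1 : Corner f).1 = f := rfl

end Corner

/-- For a left `Λ`-module `M`, the subgroup `fM = {m | f • m = m}`. -/
def cornerSubAddSubgroup (f : Λ) (M : Type u) [AddCommGroup M] [Module Λ M] :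
    AddSubgroup M where
  carrier := {m | f • m = m}
  add_mem' := by
    intro a b ha hb
    simp only [Set.mem_setOf_eq] at *
    rw [smul_add, ha, hb]
  zero_mem' := by simp
  neg_mem' := by
    intro a ha
    simp only [Set.mem_setOf_eq] at *
    rw [smul_neg, ha]

/-- `fM`, the image of a left `Λ`-module `M` under the idempotent `f`;
this is the concrete incarnation of `fΛ ⊗_Λ M`. -/
def CornerSub (f : Λ) (M : Type u) [AddCommGroup M] [Module Λ M] : Type u :=
  ↥(cornerSubAddSubgroup f M)

namespace CornerSub

variable {f : Λ} [hf : Fact (IsIdempotentElem f)]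
variable {M : Type u} [AddCommGroup M] [Module Λ M]

instance : AddCommGroup (CornerSub f M) :=
  inferInstanceAs (AddCommGroup ↥(cornerSubAddSubgroup f M))

instance : SMul (Corner f) (CornerSub f M) :=
  ⟨fun a m => ⟨a.1 • m.1, by
    show f • a.1 • m.1 = a.1 • m.1
    rw [smul_smul, Corner.absorb_left a.2]⟩⟩

@[simp] theorem smul_val (a : Corner f) (m : CornerSub f M) :
    (a • m).1 = a.1 • m.1 := rfl

instance : Module (Corner f) (CornerSub f M) where
  one_smul m := Subtype.ext m.2
  mul_smul a b m := Subtype.ext (mul_smul a.1 b.1 m.1)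
  smul_add a m n := Subtype.ext (smul_add a.1 m.1 n.1)
  add_smul a b m := Subtype.ext (add_smul a.1 b.1 m.1)
  zero_smul m := Subtype.ext (zero_smul Λ m.1)
  smul_zero a := Subtype.ext (smul_zero a.1)

end CornerSub

/-- The functorial action of `M ↦ fM` on a `Λ`-linear map. -/
def cornerMap (f : Λ) [hf : Fact (IsIdempotentElem f)]
    {M N : Type u} [AddCommGroup M] [Module Λ M] [AddCommGroup N] [Module Λ N]
    (g : M →ₗ[Λ] N) : CornerSub f M →ₗ[Corner f] CornerSub f N where
  toFun m := ⟨g m.1, by show f • g m.1 = g m.1; rw [← map_smul, m.2]⟩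
  map_add' m n := Subtype.ext (map_add g m.1 n.1)
  map_smul' a m := Subtype.ext (map_smul g a.1 m.1)

/-- The left ideal `Λe`. -/
def lambdaE (e : Λ) : Submodule Λ Λ :=
  LinearMap.range (LinearMap.toSpanSingleton Λ Λ e)

/-- The Jacobson radical of a ring. -/
def jacRad (Λ : Type u) [Ring Λ] : Ideal Λ := Ideal.jacobson (⊥ : Ideal Λ)

end CornerLib

open CategoryTheory

/-- The `n`-th syzygy of a projective resolution `(P, d, ε)` of `X`:
`Ω⁰ = X` and `Ωⁿ⁺¹ = Im(dₙ : Pⁿ⁺¹ → Pⁿ)`. -/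
def syzObj {R : Type u} [Ring R] (X : ModuleCat.{u} R) (P : ℕ → ModuleCat.{u} R)
    (d : ∀ n, (P (n + 1) : Type u) →ₗ[R] (P n : Type u)) : ℕ → ModuleCat.{u} R
  | 0 => X
  | n + 1 => ModuleCat.of R ↥(LinearMap.range (d n))

namespace SyzAux

open CategoryTheory.Abelian

/-- Natural isomorphism of functors `Ext^s(A, -)` and `Ext^t(B, -)`. -/
def NatIso {R : Type u} [Ring R] [HasExt.{u} (ModuleCat.{u} R)] (A : ModuleCat.{u} R) (s : ℕ)
    (B : ModuleCat.{u} R) (t : ℕ) : Prop :=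
  ∃ φ : ∀ N : ModuleCat.{u} R, Abelian.Ext A N s ≃+ Abelian.Ext B N t,
    ∀ (N N' : ModuleCat.{u} R) (g : N ⟶ N') (α : Abelian.Ext A N s),
      φ N' (α.comp (Abelian.Ext.mk₀ g) (add_zero s)) =
        (φ N α).comp (Abelian.Ext.mk₀ g) (add_zero t)

section
variable {R : Type u} [Ring R]

section
variable [HasExt.{u} (ModuleCat.{u} R)]

theorem NatIso.refl (A : ModuleCat.{u} R) (s : ℕ) : NatIso A s A s :=
  ⟨fun _ => AddEquiv.refl _, fun _ _ _ _ => rfl⟩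

theorem NatIso.symm {A B : ModuleCat.{u} R} {s t : ℕ} (h : NatIso A s B t) : NatIso B t A s := by
  obtain ⟨φ, hφ⟩ := h
  refine ⟨fun N => (φ N).symm, fun N N' g α => ?_⟩
  rw [AddEquiv.symm_apply_eq, hφ, AddEquiv.apply_symm_apply]

theorem NatIso.trans {A B C : ModuleCat.{u} R} {s t r : ℕ} (h : NatIso A s B t)
    (h' : NatIso B t C r) : NatIso A s C r := by
  obtain ⟨φ, hφ⟩ := h
  obtain ⟨ψ, hψ⟩ := h'
  refine ⟨fun N => (φ N).trans (ψ N), fun N N' g α => ?_⟩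
  simp only [AddEquiv.trans_apply, hφ, hψ]

theorem natIso_of_shortExact {S : ShortComplex (ModuleCat.{u} R)} (hS : S.ShortExact) (k t : ℕ)
    (hk : HasProjectiveDimensionLT S.X₂ k) (ht : k ≤ t) : NatIso S.X₁ t S.X₃ (t + 1) := by
  have hbij : ∀ N, Function.Bijective (hS.extClass.precomp N (add_comm 1 t)) := by
    intro N
    constructor
    · rw [injective_iff_map_eq_zero]
      intro x hx
      obtain ⟨x₂, rfl⟩ := Ext.contravariant_sequence_exact₁ hS _ x (add_comm 1 t) hx
      rw [x₂.eq_zero_of_hasProjectiveDimensionLT k ht, Ext.comp_zero]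
    · intro x
      exact Ext.contravariant_sequence_exact₃ hS N x
        (Ext.eq_zero_of_hasProjectiveDimensionLT _ k (by omega)) (add_comm 1 t)
  refine ⟨fun N => AddEquiv.ofBijective _ (hbij N), fun N N' g α => ?_⟩
  simp [AddEquiv.ofBijective_apply]

end

/-- The short complex attached to a short exact sequence of linear maps. -/
abbrev mkSC {A B C : Type u} [AddCommGroup A] [Module R A] [AddCommGroup B] [Module R B]
    [AddCommGroup C] [Module R C] (i : A →ₗ[R] B) (p : B →ₗ[R] C)
    (hex : Function.Exact i p) : ShortComplex (ModuleCat.{u} R) :=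
  ShortComplex.mk (ModuleCat.ofHom i) (ModuleCat.ofHom p) (by
    ext x
    exact hex.apply_apply_eq_zero x)

theorem mkSC_shortExact {A B C : Type u} [AddCommGroup A] [Module R A] [AddCommGroup B] [Module R B]
    [AddCommGroup C] [Module R C] (i : A →ₗ[R] B) (p : B →ₗ[R] C)
    (hex : Function.Exact i p) (hi : Function.Injective i) (hp : Function.Surjective p) :
    (mkSC i p hex).ShortExact :=
  ModuleCat.shortComplex_shortExact _ hex hi hp

theorem finsupp_projective (ι : Type u) (A : Type u) [AddCommGroup A] [Module R A]
    (h : Module.Projective R A) : Module.Projective R (ι →₀ A) := by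
  classical
  exact Module.Projective.of_equiv (finsuppLequivDFinsupp (ι := ι) (M := A) R).symm

theorem pd_finsupp_step (ι : Type u) (c : ℕ) {K B A : Type u} [AddCommGroup K] [Module R K]
    [AddCommGroup B] [Module R B] [AddCommGroup A] [Module R A]
    (i : K →ₗ[R] B) (p : B →ₗ[R] A) (hex : Function.Exact i p) (hi : Function.Injective i)
    (hp : Function.Surjective p) (hB : Module.Projective R B)
    (hA : HasProjectiveDimensionLT (ModuleCat.of R A) (c + 2))
    (hstep : HasProjectiveDimensionLT (ModuleCat.of R K) (c + 1) →
      HasProjectiveDimensionLT (ModuleCat.of R (ι →₀ K)) (c + 1)) :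
    HasProjectiveDimensionLT (ModuleCat.of R (ι →₀ A)) (c + 2) := by
  have hS := mkSC_shortExact i p hex hi hp
  have hproj : Projective (mkSC i p hex).X₂ := (IsProjective.iff_projective _).mp hB
  have hK := hstep ((hS.hasProjectiveDimensionLT_X₃_iff c hproj).mp hA)
  let i' : (ι →₀ K) →ₗ[R] (ι →₀ B) := Finsupp.mapRange.linearMap i
  let p' : (ι →₀ B) →ₗ[R] (ι →₀ A) := Finsupp.mapRange.linearMap p
  have hi' : Function.Injective i' := Finsupp.mapRange_injective _ (map_zero _) hi
  have hp' : Function.Surjective p' := Finsupp.mapRange_surjective _ (map_zero _) hp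
  have hex' : Function.Exact i' p' := by
    intro x
    constructor
    · intro hx
      have hx' : ∀ j, ∃ y, i y = x j := fun j =>
        (hex (x j)).mp (by simpa [p'] using DFunLike.congr_fun hx j)
      choose y hy using hx'
      refine ⟨Finsupp.onFinset x.support y ?_, ?_⟩
      · intro j hj
        rw [Finsupp.mem_support_iff]
        intro h0
        exact hj (hi (by rw [hy, h0, map_zero]))
      · ext j : 1
        simp [i', hy]
    · rintro ⟨y, rfl⟩
      ext j
      simpa [i', p'] using hex.apply_apply_eq_zero (y j)
  have hS' := mkSC_shortExact i' p' hex' hi' hp'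
  have hproj' : Projective (mkSC i' p' hex').X₂ :=
    (IsProjective.iff_projective _).mp (finsupp_projective ι B hB)
  exact (hS'.hasProjectiveDimensionLT_X₃_iff c hproj').mpr hK

theorem pd_finsupp_ker (ι : Type u) (c : ℕ) {B A : Type u}
    [AddCommGroup B] [Module R B] [AddCommGroup A] [Module R A]
    (p : B →ₗ[R] A) (hp : Function.Surjective p) (hB : Module.Projective R B)
    (hA : HasProjectiveDimensionLT (ModuleCat.of R A) (c + 2))
    (hstep : ∀ K : Submodule R B, HasProjectiveDimensionLT (ModuleCat.of R K) (c + 1) →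
      HasProjectiveDimensionLT (ModuleCat.of R (ι →₀ K)) (c + 1)) :
    HasProjectiveDimensionLT (ModuleCat.of R (ι →₀ A)) (c + 2) := by
  refine pd_finsupp_step ι c (LinearMap.ker p).subtype p ?_ (Submodule.injective_subtype _) hp
    hB hA (hstep _)
  rw [LinearMap.exact_iff, Submodule.range_subtype]

theorem pd_finsupp (ι : Type u) (c : ℕ) : ∀ (A : Type u) [AddCommGroup A] [Module R A],
    HasProjectiveDimensionLT (ModuleCat.of R A) (c + 1) →
    HasProjectiveDimensionLT (ModuleCat.of R (ι →₀ A)) (c + 1) := by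
  induction c with
  | zero =>
    intro A _ _ h
    rw [zero_add, ← projective_iff_hasProjectiveDimensionLT_one,
      ← IsProjective.iff_projective] at h ⊢
    exact finsupp_projective ι A h
  | succ c ih =>
    intro A _ _ h
    have hp : Function.Surjective (Finsupp.linearCombination R (id : A → A)) :=
      fun a => ⟨Finsupp.single a 1, by simp⟩
    exact pd_finsupp_ker ι c (Finsupp.linearCombination R (id : A → A)) hp inferInstance h
      (fun K => ih K)

theorem pd_retract {A B : Type u} [AddCommGroup A] [Module R A] [AddCommGroup B] [Module R B]
    (i : A →ₗ[R] B) (r : B →ₗ[R] A) (h : ∀ a, r (i a) = a) (k : ℕ)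
    (hB : HasProjectiveDimensionLT (ModuleCat.of R B) k) :
    HasProjectiveDimensionLT (ModuleCat.of R A) k := by
  have ret : Retract (ModuleCat.of R A) (ModuleCat.of R B) :=
    { i := ModuleCat.ofHom i, r := ModuleCat.ofHom r, retract := by ext a; exact h a }
  exact ret.hasProjectiveDimensionLT k

theorem pd_prod {A B : Type u} [AddCommGroup A] [Module R A] [AddCommGroup B] [Module R B] (k : ℕ)
    (hA : HasProjectiveDimensionLT (ModuleCat.of R A) k)
    (hB : HasProjectiveDimensionLT (ModuleCat.of R B) k) :
    HasProjectiveDimensionLT (ModuleCat.of R (A × B)) k := by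
  have hS := mkSC_shortExact (LinearMap.inl R A B) (LinearMap.snd R A B)
    .inl_snd LinearMap.inl_injective LinearMap.snd_surjective
  exact hS.hasProjectiveDimensionLT_X₂ k hA hB

/-- The short exact sequences of syzygies. -/
theorem syz_seq (X : ModuleCat.{u} R) (P : ℕ → ModuleCat.{u} R)
    (d : ∀ n, (P (n + 1) : Type u) →ₗ[R] (P n : Type u)) (ε : (P 0 : Type u) →ₗ[R] X)
    (hsurj : Function.Surjective ε)
    (hex0 : LinearMap.range (d 0) = LinearMap.ker ε)
    (hex : ∀ n, LinearMap.range (d (n + 1)) = LinearMap.ker (d n)) (n : ℕ) :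
    ∃ (i : (syzObj X P d (n + 1) : Type u) →ₗ[R] (P n : Type u))
      (p : (P n : Type u) →ₗ[R] (syzObj X P d n : Type u)),
      Function.Exact i p ∧ Function.Injective i ∧ Function.Surjective p := by
  cases n with
  | zero =>
    refine ⟨(LinearMap.range (d 0)).subtype, ε, ?_, Submodule.injective_subtype _, hsurj⟩
    have : Function.Exact (LinearMap.range (d 0)).subtype ε := by
      rw [LinearMap.exact_iff, Submodule.range_subtype, hex0]
    exact this
  | succ n =>
    refine ⟨(LinearMap.range (d (n + 1))).subtype, (d n).rangeRestrict, ?_,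
      Submodule.injective_subtype _, (d n).surjective_rangeRestrict⟩
    have : Function.Exact (LinearMap.range (d (n + 1))).subtype (d n).rangeRestrict := by
      rw [LinearMap.exact_iff, Submodule.range_subtype, hex, LinearMap.ker_rangeRestrict]
    exact this

theorem natIso_syz [HasExt.{u} (ModuleCat.{u} R)] (Y : ℕ → ModuleCat.{u} R) (k : ℕ)
    (h : ∀ n t, k ≤ t → NatIso (Y (n + 1)) t (Y n) (t + 1)) (n : ℕ) :
    ∀ t m, k ≤ t → m = t + n → NatIso (Y n) t (Y 0) m := by
  induction n with
  | zero => rintro t m - rfl; exact NatIso.refl _ _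
  | succ n ih => intro t m ht hm; exact (h n t ht).trans (ih (t + 1) m (by omega) (by omega))

end

section
variable {Λ : Type u} [Ring Λ]

section
variable (f : Λ) [hf : Fact (IsIdempotentElem f)]
variable {A B C : Type u} [AddCommGroup A] [Module Λ A] [AddCommGroup B] [Module Λ B]
    [AddCommGroup C] [Module Λ C]

theorem cornerMap_injective (i : A →ₗ[Λ] B) (hi : Function.Injective i) :
    Function.Injective (cornerMap f i) := fun x y h =>
  Subtype.ext (hi (congrArg Subtype.val h))

theorem cornerMap_surjective (p : A →ₗ[Λ] B) (hp : Function.Surjective p) :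
    Function.Surjective (cornerMap f p) := fun y => by
  obtain ⟨x, hx⟩ := hp y.1
  refine ⟨⟨f • x, ?_⟩, Subtype.ext ?_⟩
  · show f • f • x = f • x
    rw [smul_smul, hf.out]
  · show p (f • x) = y.1
    rw [map_smul, hx]
    exact y.2

theorem cornerMap_exact (i : A →ₗ[Λ] B) (p : B →ₗ[Λ] C) (hi : Function.Injective i)
    (h : Function.Exact i p) :
    Function.Exact (cornerMap f i) (cornerMap f p) := by
  intro y
  constructor
  · intro hy
    obtain ⟨x, hx⟩ := (h y.1).mp (congrArg Subtype.val hy)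
    refine ⟨⟨x, ?_⟩, Subtype.ext hx⟩
    apply hi
    show i (f • x) = i x
    rw [map_smul, hx]
    exact y.2
  · rintro ⟨x, rfl⟩
    exact Subtype.ext (h.apply_apply_eq_zero x.1)

end

variable (e : Λ) [he : Fact (IsIdempotentElem e)]

/-- `fM` for `M` free embeds in sums of copies of `fΛf × fΛe`. -/
theorem pd_corner_free (ι : Type u) (k : ℕ)
    (h : HasProjectiveDimensionLT
      (ModuleCat.of (Corner (1 - e)) (CornerSub (1 - e) ↥(lambdaE e))) (k + 1)) :
    HasProjectiveDimensionLT
      (ModuleCat.of (Corner (1 - e)) (CornerSub (1 - e) (ι →₀ Λ))) (k + 1) := by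
  have h1 : HasProjectiveDimensionLT
      (ModuleCat.of (Corner (1 - e)) (Corner (1 - e))) (k + 1) := by
    have : Projective (ModuleCat.of (Corner (1 - e)) (Corner (1 - e))) :=
      (IsProjective.iff_projective _).mp inferInstance
    exact hasProjectiveDimensionLT_of_ge _ 1 _ (by omega)
  have h2 := pd_finsupp ι k _ (pd_prod (k + 1) h1 h)
  let f : Λ := 1 - e
  have hff : f * f = f := he.out.one_sub
  have hee : e * e = e := he.out
  -- coordinates
  let a : CornerSub f Λ →ₗ[Corner f] Corner f × CornerSub f ↥(lambdaE e) :=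
    { toFun := fun x => (⟨x.1 * f, by
          have hx : f * x.1 = x.1 := x.2
          show f * (x.1 * f) * f = x.1 * f
          rw [← mul_assoc, hx, mul_assoc, hff]⟩,
        ⟨⟨x.1 * e, x.1, rfl⟩, Subtype.ext (by
          have hx : f * x.1 = x.1 := x.2
          show f * (x.1 * e) = x.1 * e
          rw [← mul_assoc, hx])⟩)
      map_add' := fun x y => Prod.ext (Subtype.ext (add_mul x.1 y.1 f))
        (Subtype.ext (Subtype.ext (add_mul x.1 y.1 e)))
      map_smul' := fun r x => Prod.ext (Subtype.ext (mul_assoc r.1 x.1 f))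
        (Subtype.ext (Subtype.ext (mul_assoc r.1 x.1 e))) }
  let b : Corner f × CornerSub f ↥(lambdaE e) →ₗ[Corner f] CornerSub f Λ :=
    { toFun := fun y => ⟨y.1.1 + y.2.1.1, by
          have h1 : f * y.1.1 = y.1.1 := Corner.absorb_left y.1.2
          have h2 : f * y.2.1.1 = y.2.1.1 := congrArg Subtype.val y.2.2
          show f * (y.1.1 + y.2.1.1) = _
          rw [mul_add, h1, h2]⟩
      map_add' := fun x y => Subtype.ext (add_add_add_comm x.1.1 y.1.1 x.2.1.1 y.2.1.1)
      map_smul' := fun r x => Subtype.ext (mul_add r.1 x.1.1 x.2.1.1).symm }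
  have hba : ∀ x, b (a x) = x := fun x => Subtype.ext (by
    show x.1 * (1 - e) + x.1 * e = x.1
    rw [← mul_add, sub_add_cancel, mul_one])
  -- coordinatewise comparison of `f(Λ^(ι))` and `(fΛ)^(ι)`
  let s : CornerSub f (ι →₀ Λ) →ₗ[Corner f] (ι →₀ CornerSub f Λ) :=
    { toFun := fun x => Finsupp.onFinset x.1.support
        (fun j => ⟨x.1 j, DFunLike.congr_fun (x.2 : f • x.1 = x.1) j⟩) (fun j hj => by
          rw [Finsupp.mem_support_iff]
          intro h0
          exact hj (Subtype.ext h0))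
      map_add' := fun x y => by ext j : 1; rfl
      map_smul' := fun r x => by ext j : 1; rfl }
  let r : (ι →₀ CornerSub f Λ) →ₗ[Corner f] CornerSub f (ι →₀ Λ) :=
    { toFun := fun y => ⟨Finsupp.mapRange (fun z : CornerSub f Λ => z.1) rfl y, by
          show f • _ = _
          ext j
          exact (y j).2⟩
      map_add' := fun x y => Subtype.ext (by ext j; rfl)
      map_smul' := fun c x => Subtype.ext (by ext j; rfl) }
  have hrs : ∀ x, r (s x) = x := fun x => Subtype.ext (by ext j; rfl)
  refine pd_retract ((Finsupp.mapRange.linearMap a).comp s)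
    (r.comp (Finsupp.mapRange.linearMap b)) (fun x => ?_) (k + 1) h2
  have : Finsupp.mapRange.linearMap b (Finsupp.mapRange.linearMap (α := ι) a (s x)) = s x := by
    ext j : 1
    exact hba _
  exact (congrArg r this).trans (hrs x)

theorem pd_corner_proj (k : ℕ)
    (h : HasProjectiveDimensionLT
      (ModuleCat.of (Corner (1 - e)) (CornerSub (1 - e) ↥(lambdaE e))) (k + 1))
    (P : Type u) [AddCommGroup P] [Module Λ P] (hP : Module.Projective Λ P) :
    HasProjectiveDimensionLT
      (ModuleCat.of (Corner (1 - e)) (CornerSub (1 - e) P)) (k + 1) := by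
  obtain ⟨s, hs⟩ := hP.out
  exact pd_retract (cornerMap (1 - e) s) (cornerMap (1 - e) (Finsupp.linearCombination Λ id))
    (fun a => Subtype.ext (hs a.1)) (k + 1) (pd_corner_free e P k h)

end

end SyzAux

theorem ext_of_syzygies_naturally_isomorphic
    {Λ : Type u} [Ring Λ] (e : Λ) [he : Fact (IsIdempotentElem e)]
    [HasExt.{u} (ModuleCat.{u} (Corner (1 - e)))]
    (c : ℕ)
    (hpd : ∀ (N : ModuleCat.{u} (Corner (1 - e))) (k : ℕ), c < k →
      Subsingleton (Abelian.Ext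
        (ModuleCat.of (Corner (1 - e)) (CornerSub (1 - e) ↥(lambdaE e))) N k))
    (X : ModuleCat.{u} Λ)
    -- a projective resolution of `X` over `Λ`
    (P : ℕ → ModuleCat.{u} Λ) (hPproj : ∀ n, Module.Projective Λ (P n))
    (d : ∀ n, (P (n + 1) : Type u) →ₗ[Λ] (P n : Type u))
    (ε : (P 0 : Type u) →ₗ[Λ] X)
    (hsurj : Function.Surjective ε)
    (hex0 : LinearMap.range (d 0) = LinearMap.ker ε)
    (hex : ∀ n, LinearMap.range (d (n + 1)) = LinearMap.ker (d n))
    -- a projective resolution of `F(X) = fX` over `Λ* = fΛf`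
    (Q : ℕ → ModuleCat.{u} (Corner (1 - e)))
    (hQproj : ∀ n, Module.Projective (Corner (1 - e)) (Q n))
    (dQ : ∀ n, (Q (n + 1) : Type u) →ₗ[Corner (1 - e)] (Q n : Type u))
    (εQ : (Q 0 : Type u) →ₗ[Corner (1 - e)] CornerSub (1 - e) X)
    (hsurjQ : Function.Surjective εQ)
    (hexQ0 : LinearMap.range (dQ 0) = LinearMap.ker εQ)
    (hexQ : ∀ n, LinearMap.range (dQ (n + 1)) = LinearMap.ker (dQ n))
    (t n : ℕ) (ht : c + 1 < t) :
    ∃ φ : ∀ N : ModuleCat.{u} (Corner (1 - e)),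
        Abelian.Ext (ModuleCat.of (Corner (1 - e))
            (CornerSub (1 - e) ↥(syzObj X P d n))) N t ≃+
          Abelian.Ext (syzObj (ModuleCat.of (Corner (1 - e)) (CornerSub (1 - e) X)) Q dQ n)
            N t,
      ∀ (N N' : ModuleCat.{u} (Corner (1 - e))) (g : N ⟶ N')
        (α : Abelian.Ext (ModuleCat.of (Corner (1 - e))
            (CornerSub (1 - e) ↥(syzObj X P d n))) N t),
        φ N' (α.comp (Abelian.Ext.mk₀ g) (add_zero t)) =
          (φ N α).comp (Abelian.Ext.mk₀ g) (add_zero t) := by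
  have hpd' : HasProjectiveDimensionLT
      (ModuleCat.of (Corner (1 - e)) (CornerSub (1 - e) ↥(lambdaE e))) (c + 1) :=
    HasProjectiveDimensionLT.mk (fun i hi Y x => (hpd Y i hi).elim _ _)
  have h1 := SyzAux.natIso_syz
    (fun n => ModuleCat.of (Corner (1 - e)) (CornerSub (1 - e) ↥(syzObj X P d n))) (c + 1)
    (fun n t ht => by
      obtain ⟨i, p, hip, hi, hp⟩ := SyzAux.syz_seq X P d ε hsurj hex0 hex n
      exact SyzAux.natIso_of_shortExact (SyzAux.mkSC_shortExact _ _
        (SyzAux.cornerMap_exact (1 - e) i p hi hip) (SyzAux.cornerMap_injective (1 - e) i hi)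
        (SyzAux.cornerMap_surjective (1 - e) p hp)) (c + 1) t
        (SyzAux.pd_corner_proj e c hpd' (P n) (hPproj n)) ht) n t (t + n) (by omega) rfl
  have h2 := SyzAux.natIso_syz
    (fun n => syzObj (ModuleCat.of (Corner (1 - e)) (CornerSub (1 - e) X)) Q dQ n) 1
    (fun n t ht => by
      obtain ⟨i, p, hip, hi, hp⟩ := SyzAux.syz_seq
        (ModuleCat.of (Corner (1 - e)) (CornerSub (1 - e) X)) Q dQ εQ hsurjQ hexQ0 hexQ n
      have : Projective (Q n) := (IsProjective.iff_projective _).mp (hQproj n)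
      exact SyzAux.natIso_of_shortExact (SyzAux.mkSC_shortExact i p hip hi hp) 1 t
        (inferInstanceAs (HasProjectiveDimensionLT (Q n) 1)) ht) n t (t + n) (by omega) rfl
  exact h1.trans h2.symm
end

section
/- Let Λ be a ring with Jacobson radical r and (e, f) complementary idempotents with fΛe ⊆ r. If both the projective dimension and injective dimension of (Λ/r)e over Λ are at most a < ∞, then for all n > a there is an isomorphism Ext^n_Λ((Λ/r)f, (Λ/r)f) ≅ Ext^n_Λ(Λ/r, Λ/r), and these isomorphisms are compatible with the Yoneda product, i.e. ⊕_{n>a} Ext^n_Λ((Λ/r)f, (Λ/r)f) ≅ ⊕_{n>a} Ext^n_Λ(Λ/r, Λ/r) as graded rings without identity. -/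
/-! STATEMENT 12: Let `r = J(Λ)` and `(e, f)` complementary idempotents with `fΛe ⊆ r`.
If both the projective and injective dimension of `(Λ/r)e` are at most `a < ∞`, then
for all `n > a` there are isomorphisms `Ext^n_Λ((Λ/r)f, (Λ/r)f) ≅ Ext^n_Λ(Λ/r, Λ/r)`
compatible with the Yoneda product (composition of Ext classes). -/

universe u

open CategoryTheory

/-- `(Λ/r)ε`, the image of `Λε` in `Λ/r`, as an object of `ModuleCat Λ`. -/
def radQuotPart (Λ : Type u) [Ring Λ] (ε : Λ) : ModuleCat.{u} Λ :=
  ModuleCat.of Λ ↥(Submodule.map (jacRad Λ).mkQ (lambdaE ε))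

open CategoryTheory Abelian in
theorem ext_iso_aux {C : Type*} [Category C] [Abelian C] [HasExt C] {A B M : C}
    (i : B ⟶ M) (p : M ⟶ B) (j : A ⟶ M) (q : M ⟶ A) (hip : i ≫ p = 𝟙 B)
    (hs : p ≫ i + q ≫ j = 𝟙 M) (a : ℕ)
    (hpd : ∀ (N : C) (k : ℕ), a < k → Subsingleton (Abelian.Ext A N k))
    (hid : ∀ (N : C) (k : ℕ), a < k → Subsingleton (Abelian.Ext N A k)) :
    ∃ φ : ∀ n : ℕ, a < n → (Abelian.Ext B B n ≃+ Abelian.Ext M M n),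
      ∀ (n₁ n₂ : ℕ) (h₁ : a < n₁) (h₂ : a < n₂)
        (α : Abelian.Ext B B n₁) (β : Abelian.Ext B B n₂),
        φ (n₁ + n₂) (lt_of_lt_of_le h₁ (Nat.le_add_right n₁ n₂)) (α.comp β rfl) =
          (φ n₁ h₁ α).comp (φ n₂ h₂ β) rfl := by
  have e1 : ∀ {N : C} {n : ℕ} (γ : Ext B N n),
      (Ext.mk₀ i).comp ((Ext.mk₀ p).comp γ (zero_add n)) (zero_add n) = γ := by
    intro N n γ
    rw [Ext.mk₀_comp_mk₀_assoc, hip, Ext.mk₀_id_comp]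
  have e2 : ∀ {N : C} {n : ℕ} (γ : Ext N B n),
      (γ.comp (Ext.mk₀ i) (add_zero n)).comp (Ext.mk₀ p) (add_zero n) = γ := by
    intro N n γ
    rw [Ext.comp_assoc_of_second_deg_zero, Ext.mk₀_comp_mk₀, hip, Ext.comp_mk₀_id]
  have e3 : ∀ {N : C} {n : ℕ} (_ : a < n) (γ : Ext M N n),
      (Ext.mk₀ p).comp ((Ext.mk₀ i).comp γ (zero_add n)) (zero_add n) = γ := by
    intro N n hn γ
    have := hpd N n hn
    conv_rhs => rw [← Ext.mk₀_id_comp γ, ← hs, Ext.mk₀_add, Ext.add_comp,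
      ← Ext.mk₀_comp_mk₀_assoc, ← Ext.mk₀_comp_mk₀_assoc,
      Subsingleton.elim ((Ext.mk₀ j).comp γ (zero_add n)) 0, Ext.comp_zero, add_zero]
  have e4 : ∀ {N : C} {n : ℕ} (_ : a < n) (γ : Ext N M n),
      (γ.comp (Ext.mk₀ p) (add_zero n)).comp (Ext.mk₀ i) (add_zero n) = γ := by
    intro N n hn γ
    have := hid N n hn
    conv_rhs => rw [← Ext.comp_mk₀_id γ, ← hs, Ext.mk₀_add, Ext.comp_add,
      ← Ext.mk₀_comp_mk₀, ← Ext.mk₀_comp_mk₀,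
      ← Ext.comp_assoc_of_second_deg_zero, ← Ext.comp_assoc_of_second_deg_zero,
      Subsingleton.elim (γ.comp (Ext.mk₀ q) (add_zero n)) 0, Ext.zero_comp, add_zero]
  refine ⟨fun n hn =>
    { toFun := fun α => (Ext.mk₀ p).comp (α.comp (Ext.mk₀ i) (add_zero n)) (zero_add n)
      invFun := fun γ => (Ext.mk₀ i).comp (γ.comp (Ext.mk₀ p) (add_zero n)) (zero_add n)
      left_inv := ?_
      right_inv := ?_
      map_add' := ?_ }, ?_⟩
  · intro α
    dsimp only
    rw [Ext.comp_assoc_of_third_deg_zero, e2, e1]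
  · intro γ
    dsimp only
    rw [Ext.comp_assoc_of_third_deg_zero, e4 hn, e3 hn]
  · intro α β
    simp only [Ext.add_comp, Ext.comp_add]
  · intro n₁ n₂ h₁ h₂ α β
    dsimp
    rw [← Ext.comp_assoc_of_third_deg_zero (Ext.mk₀ p) α (Ext.mk₀ i),
      Ext.comp_assoc_of_second_deg_zero, e1,
      Ext.comp_assoc _ _ _ (zero_add n₁) rfl (by omega),
      Ext.comp_assoc_of_third_deg_zero]

/-- Right multiplication by `ε` on `Λ/r`, landing in `(Λ/r)ε`. -/
noncomputable def radProj (Λ : Type u) [Ring Λ] (ε : Λ) :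
    (Λ ⧸ jacRad Λ) →ₗ[Λ] ↥(Submodule.map (jacRad Λ).mkQ (lambdaE ε)) :=
  Submodule.liftQ (jacRad Λ)
    (((jacRad Λ).mkQ.comp (LinearMap.toSpanSingleton Λ Λ ε)).codRestrict _
      (fun x => ⟨x • ε, ⟨x, rfl⟩, rfl⟩))
    (by
      intro x hx
      rw [LinearMap.mem_ker]
      apply Subtype.ext
      change (jacRad Λ).mkQ (x * ε) = 0
      rw [Submodule.mkQ_apply, Submodule.Quotient.mk_eq_zero]
      exact Ideal.mul_mem_right (I := Ideal.jacobson (⊥ : Ideal Λ)) ε hx)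

theorem radProj_mk (Λ : Type u) [Ring Λ] (ε x : Λ) :
    (radProj Λ ε ((jacRad Λ).mkQ x)).1 = (jacRad Λ).mkQ (x * ε) := rfl

theorem ext_algebra_f_part_iso
    {Λ : Type u} [Ring Λ] [HasExt.{u} (ModuleCat.{u} Λ)]
    (e : Λ) (he : IsIdempotentElem e)
    (hsub : ∀ x : Λ, (1 - e) * x * e ∈ jacRad Λ)
    (a : ℕ)
    (hpd : ∀ (N : ModuleCat.{u} Λ) (k : ℕ), a < k →
      Subsingleton (Abelian.Ext (radQuotPart Λ e) N k))
    (hid : ∀ (N : ModuleCat.{u} Λ) (k : ℕ), a < k →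
      Subsingleton (Abelian.Ext N (radQuotPart Λ e) k)) :
    ∃ φ : ∀ n : ℕ, a < n →
        (Abelian.Ext (radQuotPart Λ (1 - e)) (radQuotPart Λ (1 - e)) n ≃+
          Abelian.Ext (ModuleCat.of Λ (Λ ⧸ jacRad Λ)) (ModuleCat.of Λ (Λ ⧸ jacRad Λ)) n),
      ∀ (n₁ n₂ : ℕ) (h₁ : a < n₁) (h₂ : a < n₂)
        (α : Abelian.Ext (radQuotPart Λ (1 - e)) (radQuotPart Λ (1 - e)) n₁)
        (β : Abelian.Ext (radQuotPart Λ (1 - e)) (radQuotPart Λ (1 - e)) n₂),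
        φ (n₁ + n₂) (lt_of_lt_of_le h₁ (Nat.le_add_right n₁ n₂)) (α.comp β rfl) =
          (φ n₁ h₁ α).comp (φ n₂ h₂ β) rfl := by
  refine ext_iso_aux
    (ModuleCat.ofHom (Submodule.subtype _) : radQuotPart Λ (1 - e) ⟶ ModuleCat.of Λ (Λ ⧸ jacRad Λ))
    (ModuleCat.ofHom (radProj Λ (1 - e)))
    (ModuleCat.ofHom (Submodule.subtype _) : radQuotPart Λ e ⟶ ModuleCat.of Λ (Λ ⧸ jacRad Λ))
    (ModuleCat.ofHom (radProj Λ e)) ?_ ?_ a hpd hid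
  · apply ModuleCat.hom_ext
    apply LinearMap.ext
    rintro ⟨_, _, ⟨x, rfl⟩, rfl⟩
    apply Subtype.ext
    change (jacRad Λ).mkQ (x * (1 - e) * (1 - e)) = (jacRad Λ).mkQ (x * (1 - e))
    rw [mul_assoc, he.one_sub.eq]
  · apply ModuleCat.hom_ext
    apply LinearMap.ext
    intro y
    obtain ⟨x, rfl⟩ := (jacRad Λ).mkQ_surjective y
    change (jacRad Λ).mkQ (x * (1 - e)) + (jacRad Λ).mkQ (x * e) = (jacRad Λ).mkQ x
    rw [← map_add, ← mul_add, sub_add_cancel, mul_one]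
end

section
/- Let Λ be a semiperfect Noetherian ring (or Artin algebra) with radical r, and (e, f) complementary idempotents with fΛe ⊆ r. Suppose pd_{Λ*}(fΛe) = c < ∞ where Λ* = fΛf, and id_Λ((Λ/r)e) = b < ∞. If X is a finitely generated Λ-module with minimal projective resolution P^•, then for every n > b the projective module P^n belongs to f (i.e., P^n/rP^n has no simple summand S with eS ≠ 0), and applying F = fΛ ⊗_Λ − to the truncated resolution P^{>b} yields a minimal projective Λ*-resolution of F(Ω^{b+1}_Λ(X)). -/
/-! STATEMENT 13: Let `Λ` be an Artin algebra with radical `r`, `(e, f)` complementary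
idempotents with `fΛe ⊆ r`, `Λ* = fΛf` with `pd_{Λ*}(fΛe) = c < ∞`, and
`id_Λ((Λ/r)e) = b < ∞`.  If `X` is a finitely generated `Λ`-module with a minimal
projective resolution `P^•`, then for `n > b` each `Pⁿ` belongs to `f` (i.e.
`e Pⁿ ⊆ r Pⁿ`), and applying `F = fΛ ⊗_Λ - ` (realized by `CornerSub f`) to the
truncation `P^{>b}` yields a minimal projective `Λ*`-resolution of `F(Ω^{b+1} X)`. -/

universe u

open CategoryTheory

/-- The submodule `rM` of a `Λ`-module `M`, for `r` the Jacobson radical. -/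
def radSub (Λ : Type u) [Ring Λ] (M : Type u) [AddCommGroup M] [Module Λ M] :
    Submodule Λ M :=
  Submodule.span Λ {x : M | ∃ a ∈ jacRad Λ, ∃ m : M, x = a • m}

/-- The submodule `r* M = (f r f) M` of a `Λ* = fΛf`-module `M`. -/
def radStarSub {Λ : Type u} [Ring Λ] (f : Λ) [Fact (IsIdempotentElem f)]
    (M : Type u) [AddCommGroup M] [Module (Corner f) M] : Submodule (Corner f) M :=
  Submodule.span (Corner f)
    {x : M | ∃ a : Corner f, a.1 ∈ jacRad Λ ∧ ∃ m : M, x = a • m}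

section Helpers

instance jacRad_twoSided (Λ : Type u) [Ring Λ] : (jacRad Λ).IsTwoSided :=
  inferInstanceAs (Ideal.jacobson (⊥ : Ideal Λ)).IsTwoSided

theorem jacRad_semiprime {Λ : Type u} [Ring Λ] {a : Λ}
    (h : ∀ y, a * y * a ∈ jacRad Λ) : a ∈ jacRad Λ := by
  refine Ideal.mem_jacobson_iff.2 fun y => ?_
  have h1 : y * (a * y * a) ∈ jacRad Λ := (jacRad Λ).mul_mem_left y (h y)
  obtain ⟨w, hw⟩ := Ideal.mem_jacobson_iff.1 h1 (-1)
  refine ⟨w * (1 - y * a), ?_⟩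
  convert hw using 1
  noncomm_ring

theorem jacRad_other {Λ : Type u} [Ring Λ] {e : Λ}
    (hsub : ∀ x : Λ, (1 - e) * x * e ∈ jacRad Λ) (x : Λ) :
    e * x * (1 - e) ∈ jacRad Λ := by
  apply jacRad_semiprime
  intro y
  have h := (jacRad Λ).mul_mem_right (x * (1 - e)) ((jacRad Λ).mul_mem_left (e * x) (hsub y))
  convert h using 1
  simp only [mul_assoc]

theorem smul_mem_radSub {Λ : Type u} [Ring Λ] {M : Type u} [AddCommGroup M] [Module Λ M]
    {a : Λ} (ha : a ∈ jacRad Λ) (m : M) : a • m ∈ radSub Λ M :=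
  Submodule.subset_span ⟨a, ha, m, rfl⟩

theorem radSub_le_ker {Λ : Type u} [Ring Λ] {M N : Type u} [AddCommGroup M] [Module Λ M]
    [AddCommGroup N] [Module Λ N] (hN : ∀ a ∈ jacRad Λ, ∀ n : N, a • n = 0)
    (φ : M →ₗ[Λ] N) : radSub Λ M ≤ LinearMap.ker φ := by
  refine Submodule.span_le.2 ?_
  rintro _ ⟨a, ha, m, rfl⟩
  simp [hN a ha]

theorem radQuotPart_killed {Λ : Type u} [Ring Λ] (ε : Λ) :
    ∀ a ∈ jacRad Λ, ∀ n : radQuotPart Λ ε, a • n = 0 := by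
  rintro a ha ⟨_, y, hy, rfl⟩
  apply Subtype.ext
  change a • (jacRad Λ).mkQ y = 0
  rw [← map_smul, Submodule.mkQ_apply, Submodule.Quotient.mk_eq_zero]
  exact (jacRad Λ).mul_mem_right y ha

/-- the map `Λ → (Λ/r)ε`, `x ↦ xε`. -/
def toRadQuot (Λ : Type u) [Ring Λ] (ε : Λ) : Λ →ₗ[Λ] radQuotPart Λ ε :=
  LinearMap.codRestrict (Submodule.map (jacRad Λ).mkQ (lambdaE ε))
    ((jacRad Λ).mkQ ∘ₗ LinearMap.toSpanSingleton Λ Λ ε)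
    (fun x => ⟨_, ⟨x, rfl⟩, rfl⟩)

theorem toRadQuot_eq_zero {Λ : Type u} [Ring Λ] (ε : Λ) {x : Λ} (h : toRadQuot Λ ε x = 0) :
    x * ε ∈ jacRad Λ := by
  have h2 : (jacRad Λ).mkQ (x * ε) = 0 := congrArg Subtype.val h
  rwa [Submodule.mkQ_apply, Submodule.Quotient.mk_eq_zero] at h2

theorem belongs_of_hom_zero {Λ : Type u} [Ring Λ] {e : Λ}
    (hsub : ∀ x : Λ, (1 - e) * x * e ∈ jacRad Λ)
    (P : Type u) [AddCommGroup P] [Module Λ P] [hP : Module.Projective Λ P]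
    (h : ∀ φ : P →ₗ[Λ] radQuotPart Λ e, φ = 0) (x : P) : e • x ∈ radSub Λ P := by
  obtain ⟨s, hs⟩ := Module.projective_def'.1 hP
  have hx : Finsupp.linearCombination Λ id (s (e • x)) = e • x := LinearMap.congr_fun hs (e • x)
  rw [← hx, Finsupp.linearCombination_apply, Finsupp.sum]
  refine Submodule.sum_mem _ fun p _ => smul_mem_radSub ?_ _
  have h1 : s x p * e ∈ jacRad Λ := by
    apply toRadQuot_eq_zero
    exact LinearMap.congr_fun (h (toRadQuot Λ e ∘ₗ Finsupp.lapply p ∘ₗ s)) x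
  have h2 := jacRad_other hsub (s x p)
  have h3 := (jacRad Λ).add_mem ((jacRad Λ).mul_mem_left e h1) h2
  rw [map_smul, Finsupp.smul_apply, smul_eq_mul]
  convert h3 using 1
  noncomm_ring

theorem ext_shift {Λ : Type u} [Ring Λ] [HasExt.{u} (ModuleCat.{u} Λ)]
    (Q N : Type u) [AddCommGroup Q] [Module Λ Q] [AddCommGroup N] [Module Λ N]
    [Module.Projective Λ Q] (S : ModuleCat.{u} Λ)
    (g : Q →ₗ[Λ] N) (hg : Function.Surjective g) (K : Submodule Λ Q)
    (hK : K = LinearMap.ker g) (k : ℕ)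
    (h : Subsingleton (Abelian.Ext (ModuleCat.of Λ N) S (k + 2))) :
    Subsingleton (Abelian.Ext (ModuleCat.of Λ K) S (k + 1)) := by
  subst hK
  have hS := LinearMap.shortExact_shortComplexKer hg
  haveI : Projective (ModuleCat.of Λ Q) := ModuleCat.projective_of_categoryTheory_projective _
  have key : ∀ x : Abelian.Ext (ModuleCat.of Λ (LinearMap.ker g)) S (k + 1), x = 0 := by
    intro x
    obtain ⟨y, hy⟩ := Abelian.Ext.contravariant_sequence_exact₁ hS S x
      (n₁ := k + 2) (by omega) (@Subsingleton.elim _ h _ _)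
    have : y = 0 := Abelian.Ext.eq_zero_of_projective (P := ModuleCat.of Λ Q) y
    rw [← hy, this, Abelian.Ext.comp_zero]
  exact ⟨fun x y => (key x).trans (key y).symm⟩

theorem ext_extend {Λ : Type u} [Ring Λ] [HasExt.{u} (ModuleCat.{u} Λ)]
    (Q N : Type u) [AddCommGroup Q] [Module Λ Q] [AddCommGroup N] [Module Λ N]
    (S : ModuleCat.{u} Λ)
    (g : Q →ₗ[Λ] N) (hg : Function.Surjective g) (K : Submodule Λ Q)
    (hK : K = LinearMap.ker g)
    (h : Subsingleton (Abelian.Ext (ModuleCat.of Λ N) S 1)) (φ : K →ₗ[Λ] S) :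
    ∃ ψ : Q →ₗ[Λ] S, ∀ x : K, ψ x = φ x := by
  subst hK
  have hS := LinearMap.shortExact_shortComplexKer hg
  obtain ⟨y, hy⟩ := Abelian.Ext.contravariant_sequence_exact₁ hS S
      (Abelian.Ext.mk₀ (ModuleCat.ofHom φ))
      (n₁ := 1) (by omega) (@Subsingleton.elim _ h _ _)
  obtain ⟨ψ, rfl⟩ := (Abelian.Ext.mk₀_bijective _ _).2 y
  rw [Abelian.Ext.mk₀_comp_mk₀] at hy
  have h2 := (Abelian.Ext.mk₀_bijective _ _).1 hy
  refine ⟨ψ.hom, fun x => ?_⟩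
  exact LinearMap.congr_fun (congrArg ModuleCat.Hom.hom h2) x

theorem hom_zero {Λ : Type u} [Ring Λ] [HasExt.{u} (ModuleCat.{u} Λ)]
    (Q' Q N : Type u) [AddCommGroup Q] [Module Λ Q] [AddCommGroup N] [Module Λ N]
    [AddCommGroup Q'] [Module Λ Q']
    (S : ModuleCat.{u} Λ) (hS : ∀ a ∈ jacRad Λ, ∀ n : S, a • n = 0)
    (d : Q' →ₗ[Λ] Q) (g : Q →ₗ[Λ] N) (hg : Function.Surjective g)
    (hK : LinearMap.range d = LinearMap.ker g)
    (hd : LinearMap.range d ≤ radSub Λ Q) (hd' : LinearMap.ker d ≤ radSub Λ Q')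
    (h : Subsingleton (Abelian.Ext (ModuleCat.of Λ N) S 1)) (φ : Q' →ₗ[Λ] S) : φ = 0 := by
  have hker : LinearMap.ker d.rangeRestrict ≤ LinearMap.ker φ := by
    rw [LinearMap.ker_rangeRestrict]
    exact hd'.trans (radSub_le_ker hS φ)
  obtain ⟨φ', hφ'⟩ : ∃ φ' : LinearMap.range d →ₗ[Λ] S, φ' ∘ₗ d.rangeRestrict = φ := by
    refine ⟨(LinearMap.ker d).liftQ φ (hd'.trans (radSub_le_ker hS φ)) ∘ₗ
      d.quotKerEquivRange.symm.toLinearMap, ?_⟩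
    ext x
    have : d.quotKerEquivRange.symm (d.rangeRestrict x) = Submodule.Quotient.mk x := by
      rw [LinearEquiv.symm_apply_eq]
      rfl
    simp only [LinearMap.comp_apply, LinearEquiv.coe_coe, this]
    exact Submodule.liftQ_apply _ _ _
  obtain ⟨ψ, hψ⟩ := ext_extend Q N S g hg _ hK h φ'
  ext x
  rw [← hφ', LinearMap.comp_apply, ← hψ]
  exact radSub_le_ker hS ψ (hd (LinearMap.mem_range_self d x))

section Corn
variable {Λ : Type u} [Ring Λ] (e : Λ) [he : Fact (IsIdempotentElem e)]
    (P : Type u) [AddCommGroup P] [Module Λ P]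

theorem fsmul_mem (x : P) : (1 - e) • (1 - e) • x = (1 - e) • x := by
  rw [smul_smul, he.out.one_sub]

theorem span_corner_top [hfin : Module.Finite Λ P] (h : ∀ x : P, e • x ∈ radSub Λ P) :
    Submodule.span Λ {x : P | (1 - e) • x = x} = ⊤ := by
  set N := Submodule.span Λ {x : P | (1 - e) • x = x} with hN
  have hle : (⊤ : Submodule Λ (P ⧸ N)) ≤ Ring.jacobson Λ • (⊤ : Submodule Λ (P ⧸ N)) := by
    rintro y -
    obtain ⟨x, rfl⟩ := N.mkQ_surjective y
    have h1 : N.mkQ x = N.mkQ (e • x) := by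
      rw [← sub_eq_zero, ← map_sub, Submodule.mkQ_apply, Submodule.Quotient.mk_eq_zero]
      refine Submodule.subset_span ?_
      have := fsmul_mem e P x
      simpa [sub_smul] using this
    rw [h1]
    have h2 : radSub Λ P ≤ (Ring.jacobson Λ • (⊤ : Submodule Λ (P ⧸ N))).comap N.mkQ := by
      refine Submodule.span_le.2 ?_
      rintro _ ⟨a, ha, m, rfl⟩
      change N.mkQ (a • m) ∈ Ring.jacobson Λ • (⊤ : Submodule Λ (P ⧸ N))
      rw [map_smul]
      refine Submodule.smul_mem_smul ?_ trivial
      rw [← Ideal.jacobson_bot]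
      exact ha
    exact h2 (h x)
  have h3 : (⊤ : Submodule Λ (P ⧸ N)) = ⊥ :=
    Submodule.FG.eq_bot_of_le_jacobson_smul Module.Finite.fg_top hle
  have : Subsingleton (P ⧸ N) := by
    rw [← Submodule.subsingleton_iff Λ]
    exact subsingleton_of_bot_eq_top h3.symm
  exact Submodule.Quotient.subsingleton_iff.1 this

/-- `a ↦ faf`. -/
def cornerCompress (f : Λ) [hf : Fact (IsIdempotentElem f)] : Λ →+ Corner f where
  toFun a := ⟨f * a * f, by
    change f * (f * a * f) * f = f * a * f
    have h := hf.out.eq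
    rw [mul_assoc f a f, ← mul_assoc f f, h, mul_assoc, mul_assoc, h]⟩
  map_zero' := Subtype.ext (by change f * 0 * f = 0; simp)
  map_add' a b := Subtype.ext (by
    change f * (a + b) * f = f * a * f + f * b * f
    rw [mul_add, add_mul])

theorem cornerCompress_smul (f : Λ) [hf : Fact (IsIdempotentElem f)] (c : Corner f) (a : Λ) :
    cornerCompress f (c.1 * a) = c * cornerCompress f a := by
  apply Subtype.ext
  change f * (c.1 * a) * f = c.1 * (f * a * f)
  rw [← mul_assoc f, Corner.absorb_left c.2]
  conv_rhs => rw [← mul_assoc, ← mul_assoc, Corner.absorb_right c.2]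

theorem cornerCompress_smul_val (f : Λ) [hf : Fact (IsIdempotentElem f)] (a : Λ)
    (x : CornerSub f P) : (cornerCompress f a • x).1 = f • a • x.1 := by
  change (f * a * f) • x.1 = _
  rw [mul_smul, mul_smul, x.2]

/-- inclusion -/
def cornerIncl (f : Λ) : CornerSub f P →+ P := (cornerSubAddSubgroup f P).subtype

theorem corner_projective [hP : Module.Projective Λ P]
    (h : Submodule.span Λ {x : P | (1 - e) • x = x} = ⊤) :
    Module.Projective (Corner (1 - e)) (CornerSub (1 - e) P) := by
  have hsurj : Function.Surjective
      (Finsupp.linearCombination Λ (cornerIncl P (1 - e))) := by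
    rw [← LinearMap.range_eq_top, Finsupp.range_linearCombination, ← h]
    exact congrArg (Submodule.span Λ) Subtype.range_coe
  obtain ⟨σ, hσ⟩ := LinearMap.exists_rightInverse_of_surjective _ (LinearMap.range_eq_top.2 hsurj)
  let s : CornerSub (1 - e) P →ₗ[Corner (1 - e)] (CornerSub (1 - e) P →₀ Corner (1 - e)) :=
    { toFun := fun m => Finsupp.mapRange (cornerCompress (1 - e)) (map_zero _) (σ m.1)
      map_add' := by
        intro m n
        ext1 x
        have : σ (m + n).1 = σ m.1 + σ n.1 := map_add σ m.1 n.1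
        rw [this]
        exact map_add (cornerCompress (1 - e)) (σ m.1 x) (σ n.1 x)
      map_smul' := by
        intro c m
        ext1 x
        have : σ (c • m).1 = c.1 • σ m.1 := map_smul σ c.1 m.1
        rw [this]
        exact cornerCompress_smul (1 - e) c (σ m.1 x) }
  refine Module.projective_def'.2 ⟨s, ?_⟩
  ext1 m
  apply Subtype.ext
  have h1 : Finsupp.linearCombination Λ (cornerIncl P (1 - e)) (σ m.1)
      = m.1 := LinearMap.congr_fun hσ m.1
  change cornerIncl P (1 - e) (Finsupp.linearCombination _ id (s m)) = m.1
  rw [Finsupp.linearCombination_apply]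
  change cornerIncl P (1 - e) ((Finsupp.mapRange (cornerCompress (1 - e)) (map_zero _)
    (σ m.1)).sum fun i a => a • id i) = m.1
  rw [Finsupp.sum_mapRange_index (by intro; exact zero_smul _ _), Finsupp.sum, map_sum]
  rw [Finsupp.linearCombination_apply, Finsupp.sum] at h1
  conv_rhs => rw [← m.2, ← h1, Finset.smul_sum]
  exact Finset.sum_congr rfl fun x _ => cornerCompress_smul_val P (1 - e) _ x

theorem corner_rad (h : Submodule.span Λ {x : P | (1 - e) • x = x} = ⊤)
    (x : CornerSub (1 - e) P) (hx : x.1 ∈ radSub Λ P) :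
    x ∈ radStarSub (1 - e) (CornerSub (1 - e) P) := by
  let F : P →+ CornerSub (1 - e) P :=
    { toFun := fun p => ⟨(1 - e) • p, fsmul_mem e P p⟩
      map_zero' := Subtype.ext (smul_zero _)
      map_add' := fun p q => Subtype.ext (smul_add _ p q) }
  have h2 : ∀ m : P, ∀ a ∈ jacRad Λ, F (a • m) ∈ radStarSub (1 - e) (CornerSub (1 - e) P) := by
    intro m
    have hm : m ∈ Submodule.span Λ {x : P | (1 - e) • x = x} := h ▸ trivial
    induction hm using Submodule.span_induction with
    | mem y hy =>
      intro a ha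
      refine Submodule.subset_span ⟨cornerCompress (1 - e) a, ?_, ⟨y, hy⟩, ?_⟩
      · exact (jacRad Λ).mul_mem_right _ ((jacRad Λ).mul_mem_left _ ha)
      · exact Subtype.ext (cornerCompress_smul_val P (1 - e) a ⟨y, hy⟩).symm
    | zero => intro a _; rw [smul_zero, map_zero]; exact Submodule.zero_mem _
    | add y z _ _ hy hz =>
      intro a ha; rw [smul_add, map_add]; exact Submodule.add_mem _ (hy a ha) (hz a ha)
    | smul b y _ hy =>
      intro a ha; rw [smul_smul]; exact hy _ ((jacRad Λ).mul_mem_right b ha)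
  have h3 : ∀ y ∈ radSub Λ P, ∀ b : Λ, F (b • y) ∈ radStarSub (1 - e) (CornerSub (1 - e) P) := by
    intro y hy
    induction hy using Submodule.span_induction with
    | mem y hy =>
      obtain ⟨a, ha, m, rfl⟩ := hy
      intro b
      rw [smul_smul]
      exact h2 m _ ((jacRad Λ).mul_mem_left b ha)
    | zero => intro a; rw [smul_zero, map_zero]; exact Submodule.zero_mem _
    | add y z _ _ hy hz =>
      intro a; rw [smul_add, map_add]; exact Submodule.add_mem _ (hy a) (hz a)
    | smul b y _ hy =>
      intro a; rw [smul_smul]; exact hy _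
  have h4 : F ((1 : Λ) • x.1) = x := by
    rw [one_smul]; exact Subtype.ext x.2
  rw [← h4]
  exact h3 _ hx 1

theorem corner_exact (Q R : Type u) [AddCommGroup Q] [Module Λ Q] [AddCommGroup R] [Module Λ R]
    (g : P →ₗ[Λ] Q) (g' : Q →ₗ[Λ] R) (h : LinearMap.range g = LinearMap.ker g') :
    LinearMap.range (cornerMap (1 - e) g) = LinearMap.ker (cornerMap (1 - e) g') := by
  ext y
  constructor
  · rintro ⟨x, rfl⟩
    apply Subtype.ext
    exact (h ▸ LinearMap.mem_range_self g x.1 : g x.1 ∈ LinearMap.ker g')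
  · intro hy
    have h1 : y.1 ∈ LinearMap.ker g' := congrArg Subtype.val hy
    rw [← h] at h1
    obtain ⟨x, hx⟩ := h1
    refine ⟨⟨(1 - e) • x, fsmul_mem e P x⟩, Subtype.ext ?_⟩
    change g ((1 - e) • x) = y.1
    rw [map_smul, hx]
    exact y.2

theorem corner_surj (Q : Type u) [AddCommGroup Q] [Module Λ Q]
    (g : P →ₗ[Λ] Q) (h : Function.Surjective g) :
    Function.Surjective (cornerMap (1 - e) g) := by
  intro y
  obtain ⟨x, hx⟩ := h y.1
  refine ⟨⟨(1 - e) • x, fsmul_mem e P x⟩, Subtype.ext ?_⟩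
  change g ((1 - e) • x) = y.1
  rw [map_smul, hx]
  exact y.2

end Corn

end Helpers

theorem truncated_resolution_comparison
    {Λ : Type u} [Ring Λ]
    -- `Λ` is an Artin algebra over a commutative artinian ring `C`
    (C : Type u) [CommRing C] [IsArtinianRing C] [Algebra C Λ] [Module.Finite C Λ]
    (e : Λ) [he : Fact (IsIdempotentElem e)]
    [HasExt.{u} (ModuleCat.{u} Λ)] [HasExt.{u} (ModuleCat.{u} (Corner (1 - e)))]
    (hsub : ∀ x : Λ, (1 - e) * x * e ∈ jacRad Λ)
    (b c : ℕ)
    -- `pd_{Λ*}(fΛe) = c < ∞`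
    (hpd : ∀ (N : ModuleCat.{u} (Corner (1 - e))) (k : ℕ), c < k →
      Subsingleton (Abelian.Ext
        (ModuleCat.of (Corner (1 - e)) (CornerSub (1 - e) ↥(lambdaE e))) N k))
    -- `id_Λ((Λ/r)e) = b < ∞`
    (hid : ∀ (N : ModuleCat.{u} Λ) (k : ℕ), b < k →
      Subsingleton (Abelian.Ext N (radQuotPart Λ e) k))
    -- `X` finitely generated, with a finitely generated minimal projective resolution
    (X : ModuleCat.{u} Λ) (hX : Module.Finite Λ X)
    (P : ℕ → ModuleCat.{u} Λ) (hPproj : ∀ n, Module.Projective Λ (P n))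
    (hPfin : ∀ n, Module.Finite Λ (P n))
    (d : ∀ n, (P (n + 1) : Type u) →ₗ[Λ] (P n : Type u))
    (ε : (P 0 : Type u) →ₗ[Λ] X)
    (hsurj : Function.Surjective ε)
    (hex0 : LinearMap.range (d 0) = LinearMap.ker ε)
    (hex : ∀ n, LinearMap.range (d (n + 1)) = LinearMap.ker (d n))
    (hmin0 : LinearMap.ker ε ≤ radSub Λ (P 0))
    (hmin : ∀ n, LinearMap.range (d n) ≤ radSub Λ (P n)) :
    -- (1) for `n > b`, `Pⁿ` belongs to `f`, i.e. `e Pⁿ ⊆ r Pⁿ`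
    (∀ n, b < n → ∀ x : (P n : Type u), e • x ∈ radSub Λ (P n)) ∧
    -- (2) the terms of `F(P^{>b})` are projective `Λ*`-modules
    (∀ n, Module.Projective (Corner (1 - e)) (CornerSub (1 - e) (P (b + n + 1)))) ∧
    -- (3) the augmentation `F(P^{b+1}) → F(Ω^{b+1} X)` is surjective
    Function.Surjective (cornerMap (1 - e) (d b).rangeRestrict) ∧
    -- (4) exactness at `F(P^{b+1})`
    LinearMap.range (cornerMap (1 - e) (d (b + 1))) =
      LinearMap.ker (cornerMap (1 - e) (d b).rangeRestrict) ∧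
    -- (5) exactness at `F(P^{b+n+2})`
    (∀ n, LinearMap.range (cornerMap (1 - e) (d (b + n + 2))) =
      LinearMap.ker (cornerMap (1 - e) (d (b + n + 1)))) ∧
    -- (6) minimality: differentials land in `r* F(P)`
    (∀ n, LinearMap.range (cornerMap (1 - e) (d (b + n + 1))) ≤
      radStarSub (1 - e) (CornerSub (1 - e) (P (b + n + 1)))) ∧
    -- (6') minimality of the augmentation (projective cover)
    LinearMap.ker (cornerMap (1 - e) (d b).rangeRestrict) ≤
      radStarSub (1 - e) (CornerSub (1 - e) (P (b + 1))) := by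
  have hS := radQuotPart_killed (Λ := Λ) e
  have hsyz : ∀ m k : ℕ, b < k + m + 2 → Subsingleton (Abelian.Ext
      (ModuleCat.of Λ (LinearMap.range (d m))) (radQuotPart Λ e) (k + 1)) := by
    intro m
    induction m with
    | zero =>
      intro k hk
      exact ext_shift _ _ _ ε hsurj _ hex0 k (hid X _ (by omega))
    | succ m ih =>
      intro k hk
      refine ext_shift _ _ _ (d m).rangeRestrict (d m).surjective_rangeRestrict _ ?_ k
        (ih (k + 1) (by omega))
      rw [LinearMap.ker_rangeRestrict, hex]
  have h1 : ∀ n, b < n → ∀ x : (P n : Type u), e • x ∈ radSub Λ (P n) := by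
    intro n hn
    obtain ⟨n, rfl⟩ : ∃ k, n = k + 1 := ⟨n - 1, by omega⟩
    apply belongs_of_hom_zero hsub
    have hk : LinearMap.ker (d n) ≤ radSub Λ (P (n + 1)) := hex n ▸ hmin (n + 1)
    cases n with
    | zero =>
      exact hom_zero _ _ X _ hS (d 0) ε hsurj hex0 (hmin 0) hk (hid X _ (by omega))
    | succ n =>
      refine hom_zero _ _ _ _ hS (d (n + 1)) (d n).rangeRestrict
        (d n).surjective_rangeRestrict ?_ (hmin _) hk (hsyz n 0 (by omega))
      rw [LinearMap.ker_rangeRestrict, hex]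
  have h2 : ∀ n, b < n → Submodule.span Λ {x : (P n : Type u) | (1 - e) • x = x} = ⊤ :=
    fun n hn => span_corner_top e _ (h1 n hn)
  have hr : LinearMap.range (d (b + 1)) = LinearMap.ker (d b).rangeRestrict := by
    rw [LinearMap.ker_rangeRestrict, hex]
  have h6 : ∀ n, LinearMap.range (cornerMap (1 - e) (d (b + n + 1))) ≤
      radStarSub (1 - e) (CornerSub (1 - e) (P (b + n + 1))) := by
    rintro n _ ⟨x, rfl⟩
    exact corner_rad e _ (h2 _ (by omega)) _ (hmin _ (LinearMap.mem_range_self _ x.1))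
  refine ⟨h1, fun n => corner_projective e _ (h2 _ (by omega)),
    corner_surj e _ _ _ (d b).surjective_rangeRestrict, corner_exact e _ _ _ _ _ hr,
    fun n => corner_exact e _ _ _ _ _ (hex _), h6, ?_⟩
  rw [← corner_exact e _ _ _ _ _ hr]
  exact h6 0
end

section
/- Let Λ be an Artin algebra with radical r, e an idempotent with f = 1 − e, fΛe ⊆ r, and Λ* = fΛf with radical r* = frf. Assume pd_{Λ*}(fΛe) = c < ∞ and id_Λ((Λ/r)e) = b < ∞. Then for every finitely generated Λ-module X and every n > b + c + 2, the functor F = fΛ ⊗_Λ − induces an isomorphism Ext^n_Λ(X, (Λ/r)f) ≅ Ext^n_{Λ*}(F(X), Λ*/r*). -/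
/-! STATEMENT 14: Let `Λ` be an Artin algebra with radical `r`, `(e, f)` a suitable
idempotent pair, `Λ* = fΛf` with radical `r* = frf`.  Assume `pd_{Λ*}(fΛe) = c < ∞`
and `id_Λ((Λ/r)e) = b < ∞`.  Then for every finitely generated `Λ`-module `X` and
every `n > b + c + 2`, `F = fΛ ⊗_Λ -` induces `Ext^n_Λ(X, (Λ/r)f) ≅ Ext^n_{Λ*}(F X, Λ*/r*)`. -/

universe u

open CategoryTheory

/-- The radical `r* = f r f` of `Λ* = fΛf`, as a left ideal of the corner ring. -/
def rStar {Λ : Type u} [Ring Λ] (f : Λ) [Fact (IsIdempotentElem f)] :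
    Ideal (Corner f) where
  carrier := {x | x.1 ∈ jacRad Λ}
  add_mem' := fun ha hb => (jacRad Λ).add_mem ha hb
  zero_mem' := (jacRad Λ).zero_mem
  smul_mem' := fun c x hx => (jacRad Λ).smul_mem c.1 hx

/-- `Λ*/r*` as an object of `ModuleCat Λ*`. -/
def starSemisimpleQuot {Λ : Type u} [Ring Λ] (f : Λ) [Fact (IsIdempotentElem f)] :
    ModuleCat.{u} (Corner f) :=
  ModuleCat.of (Corner f) (Corner f ⧸ rStar f)

section ExtTools
open Abelian
variable {R : Type u} [Ring R] [HasExt.{u} (ModuleCat.{u} R)]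

theorem ses_aux {K P Z : ModuleCat.{u} R} (i : K →ₗ[R] P) (p : P →ₗ[R] Z)
    (hi : Function.Injective i) (hp : Function.Surjective p) (h : Function.Exact i p) :
    (ShortComplex.mk (ModuleCat.ofHom i) (ModuleCat.ofHom p)
      (by ext x; exact h.apply_apply_eq_zero x)).ShortExact :=
  ModuleCat.shortComplex_shortExact _ h hi hp

theorem ext_shift_s14 {K P Z : ModuleCat.{u} R} (i : K →ₗ[R] P) (p : P →ₗ[R] Z)
    (hi : Function.Injective i) (hp : Function.Surjective p) (h : Function.Exact i p)
    (Y : ModuleCat.{u} R) (n : ℕ) (h0 : Subsingleton (Ext P Y n))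
    (h1 : Subsingleton (Ext P Y (n + 1))) :
    Nonempty (Ext K Y n ≃+ Ext Z Y (n + 1)) := by
  have hS := ses_aux i p hi hp h
  have hn : 1 + n = n + 1 := add_comm _ _
  refine ⟨AddEquiv.ofBijective (hS.extClass.precomp Y hn) ⟨?_, ?_⟩⟩
  · rw [injective_iff_map_eq_zero]
    intro x hx
    obtain ⟨y, hy⟩ := Ext.contravariant_sequence_exact₁ hS Y x hn hx
    rw [← hy]
    have : y = 0 := h0.elim _ _
    rw [this, Ext.comp_zero]
  · intro x
    exact Ext.contravariant_sequence_exact₃ hS Y x (h1.elim _ _) hn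

theorem ext_one {K P Z : ModuleCat.{u} R} (i : K →ₗ[R] P) (p : P →ₗ[R] Z)
    (hi : Function.Injective i) (hp : Function.Surjective p) (h : Function.Exact i p)
    (Y : ModuleCat.{u} R) (h1 : Subsingleton (Ext P Y 1)) :
    ∃ δ : (K →ₗ[R] Y) →+ Ext Z Y 1, Function.Surjective δ ∧
      ∀ g, δ g = 0 ↔ ∃ k : P →ₗ[R] Y, k ∘ₗ i = g := by
  have hS := ses_aux i p hi hp h
  have hn : 1 + 0 = 1 := rfl
  refine ⟨(hS.extClass.precomp Y hn).comp ((Ext.addEquiv₀ (X := K) (Y := Y)).symm.toAddMonoidHom.comp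
    (ModuleCat.homAddEquiv (M := K) (N := Y)).symm.toAddMonoidHom), ?_, ?_⟩
  · intro x
    obtain ⟨y, hy⟩ := Ext.contravariant_sequence_exact₃ hS Y x (h1.elim _ _) hn
    exact ⟨(Ext.addEquiv₀ y).hom, by
      rw [← hy]
      change (hS.extClass).comp (Ext.addEquiv₀.symm (Ext.addEquiv₀ y)) hn = _
      rw [AddEquiv.symm_apply_apply]⟩
  · intro g
    constructor
    · intro hg
      obtain ⟨y, hy⟩ := Ext.contravariant_sequence_exact₁ hS Y _ hn hg
      refine ⟨(Ext.addEquiv₀ y).hom, ?_⟩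
      obtain ⟨y, rfl⟩ := Ext.addEquiv₀.symm.surjective y
      rw [AddEquiv.apply_symm_apply]
      change (Ext.mk₀ (ModuleCat.ofHom i)).comp (Ext.mk₀ y) _ = Ext.mk₀ (ModuleCat.ofHom g) at hy
      rw [Ext.mk₀_comp_mk₀] at hy
      have := Ext.mk₀_bijective _ _ |>.1 hy
      exact congrArg ModuleCat.Hom.hom this
    · rintro ⟨k, rfl⟩
      change (hS.extClass).comp (Ext.mk₀ (ModuleCat.ofHom (k ∘ₗ i))) hn = 0
      rw [ModuleCat.ofHom_comp, ← Ext.mk₀_comp_mk₀]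
      exact hS.extClass_comp_assoc _ 

theorem ext_vanish_of_sum {ι : Type*} [Fintype ι] {M : ModuleCat.{u} R} (A : ι → ModuleCat.{u} R)
    (a : ∀ j, M →ₗ[R] A j) (b : ∀ j, A j →ₗ[R] M) (h : ∑ j, b j ∘ₗ a j = LinearMap.id)
    (N : ModuleCat.{u} R) (n : ℕ) (hA : ∀ j, Subsingleton (Ext (A j) N n)) :
    Subsingleton (Ext M N n) := by
  refine subsingleton_of_forall_eq 0 fun x => ?_
  have h1 : (∑ j, ModuleCat.ofHom (a j) ≫ ModuleCat.ofHom (b j)) = 𝟙 M := by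
    apply ModuleCat.hom_ext
    rw [ModuleCat.hom_sum, ModuleCat.hom_id, ← h]
    rfl
  rw [← Ext.mk₀_id_comp x, ← h1, Ext.mk₀_sum, Ext.sum_comp]
  refine Finset.sum_eq_zero fun j _ => ?_
  rw [← Ext.mk₀_comp_mk₀, Ext.comp_assoc_of_second_deg_zero]
  rw [(hA j).elim ((Ext.mk₀ (ModuleCat.ofHom (b j))).comp x (zero_add n)) 0, Ext.comp_zero]

theorem ext_equiv_of_linearEquiv {M N Y : ModuleCat.{u} R} (E : M ≃ₗ[R] N) (n : ℕ) :
    Nonempty (Ext Y M n ≃+ Ext Y N n) := by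
  let φ : M ≅ N := E.toModuleIso
  exact ⟨(((extFunctorObj Y n).mapIso φ).addCommGroupIsoToAddEquiv)⟩

theorem ext_zero_hom {M N : ModuleCat.{u} R} (h : Subsingleton (Ext M N 0)) (g : M →ₗ[R] N) :
    g = 0 := by
  have : Ext.mk₀ (ModuleCat.ofHom g) = Ext.mk₀ (ModuleCat.ofHom 0) := h.elim _ _
  exact congrArg ModuleCat.Hom.hom ((Ext.mk₀_bijective _ _).1 this)

theorem ext_zero_of_hom {M N : ModuleCat.{u} R} (h : ∀ g : M →ₗ[R] N, g = 0) :
    Subsingleton (Ext M N 0) := by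
  have : Subsingleton (M ⟶ N) := ⟨fun a b => ModuleCat.hom_ext ((h _).trans (h _).symm)⟩
  exact Ext.addEquiv₀.toEquiv.subsingleton

end ExtTools

theorem addEquiv_of_surj {A B A' B' : Type*} [AddCommGroup A] [AddCommGroup B] [AddCommGroup A']
    [AddCommGroup B'] (E : A ≃+ B) (s : A →+ A') (t : B →+ B') (hs : Function.Surjective s)
    (ht : Function.Surjective t) (h : ∀ a, s a = 0 ↔ t (E a) = 0) : Nonempty (A' ≃+ B') := by
  have hk : s.ker.map (E : A →+ B) = t.ker := by
    ext x
    constructor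
    · rintro ⟨a, ha, rfl⟩
      exact (h a).1 ha
    · intro hx
      exact ⟨E.symm x, (h _).2 (by simpa using hx), by simp⟩
  exact ⟨(QuotientAddGroup.quotientKerEquivOfSurjective s hs).symm.trans
    ((QuotientAddGroup.congr _ _ E hk).trans (QuotientAddGroup.quotientKerEquivOfSurjective t ht))⟩

section CornerTools
variable {Λ : Type u} [Ring Λ] {f : Λ} [hf : Fact (IsIdempotentElem f)]
variable {M N L : Type u} [AddCommGroup M] [Module Λ M] [AddCommGroup N] [Module Λ N]
  [AddCommGroup L] [Module Λ L]

theorem cornerSub_ext {x y : CornerSub f M} (h : x.1 = y.1) : x = y := Subtype.ext h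

theorem cornerMap_val (g : M →ₗ[Λ] N) (x : CornerSub f M) : (cornerMap f g x).1 = g x.1 := rfl

theorem cornerSub_zero_val : (0 : CornerSub f M).1 = 0 := rfl

theorem cornerSub_mem (m : M) : f • (f • m) = f • m := by
  rw [smul_smul, hf.out.eq]

/-- The coercion `fM → M` as an additive map. -/
def cornerVal (f : Λ) (M : Type u) [AddCommGroup M] [Module Λ M] : CornerSub f M →+ M :=
  (cornerSubAddSubgroup f M).subtype

theorem cornerVal_apply (x : CornerSub f M) : cornerVal f M x = x.1 := rfl

theorem cornerMap_inj (g : M →ₗ[Λ] N) (hg : Function.Injective g) :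
    Function.Injective (cornerMap f g) := by
  intro x y h
  exact cornerSub_ext (hg (congrArg Subtype.val h))

theorem cornerMap_surj (g : M →ₗ[Λ] N) (hg : Function.Surjective g) :
    Function.Surjective (cornerMap f g) := by
  intro y
  obtain ⟨x, hx⟩ := hg y.1
  refine ⟨⟨f • x, cornerSub_mem x⟩, cornerSub_ext ?_⟩
  change g (f • x) = _
  rw [map_smul, hx]
  exact y.2

theorem cornerMap_exact (g : M →ₗ[Λ] N) (h : N →ₗ[Λ] L) (H : Function.Exact g h) :
    Function.Exact (cornerMap f g) (cornerMap f h) := by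
  intro y
  constructor
  · intro hy
    have hy' : h y.1 = 0 := congrArg Subtype.val hy
    obtain ⟨x, hx⟩ := (H _).1 hy'
    refine ⟨⟨f • x, cornerSub_mem x⟩, cornerSub_ext ?_⟩
    change g (f • x) = _
    rw [map_smul, hx]
    exact y.2
  · rintro ⟨x, rfl⟩
    exact cornerSub_ext (H.apply_apply_eq_zero x.1)

theorem cornerMap_comp (g : M →ₗ[Λ] N) (h : N →ₗ[Λ] L) :
    cornerMap f (h ∘ₗ g) = cornerMap f h ∘ₗ cornerMap f g := rfl

theorem cornerMap_id : cornerMap f (LinearMap.id : M →ₗ[Λ] M) = LinearMap.id := rfl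

theorem cornerMap_add (g h : M →ₗ[Λ] N) : cornerMap f (g + h) = cornerMap f g + cornerMap f h := rfl

/-- `cornerMap` as an additive map. -/
def cornerMapHom (f : Λ) [hf : Fact (IsIdempotentElem f)] (M N : Type u)
    [AddCommGroup M] [Module Λ M] [AddCommGroup N] [Module Λ N] :
    (M →ₗ[Λ] N) →+ (CornerSub f M →ₗ[Corner f] CornerSub f N) where
  toFun g := cornerMap f g
  map_zero' := rfl
  map_add' _ _ := rfl

/-- right multiplication by `ε` -/
def mulR (ε : Λ) : Λ →ₗ[Λ] lambdaE ε := (LinearMap.toSpanSingleton Λ Λ ε).rangeRestrict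

theorem mulR_val (ε x : Λ) : (mulR ε x).1 = x * ε := rfl

theorem lambdaE_mul {ε : Λ} (hε : IsIdempotentElem ε) (x : lambdaE ε) : x.1 * ε = x.1 := by
  obtain ⟨_, y, rfl⟩ := x
  change y * ε * ε = y * ε
  rw [mul_assoc, hε.eq]

/-- `f(Λf) ≃ fΛf`. -/
def cornerLambda (f : Λ) [hf : Fact (IsIdempotentElem f)] :
    CornerSub f (lambdaE f) ≃ₗ[Corner f] Corner f where
  toFun x := ⟨x.1.1, by
    change f * x.1.1 * f = x.1.1
    have h1 : f * x.1.1 = x.1.1 := congrArg Subtype.val x.2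
    rw [h1, lambdaE_mul hf.out]⟩
  map_add' _ _ := rfl
  map_smul' _ _ := rfl
  invFun x := ⟨⟨x.1, ⟨x.1, Corner.absorb_right x.2⟩⟩, Subtype.ext (Corner.absorb_left x.2)⟩
  left_inv _ := rfl
  right_inv _ := rfl

variable [HasExt.{u} (ModuleCat.{u} Λ)] [HasExt.{u} (ModuleCat.{u} (Corner f))]
open Abelian

theorem ext_corner_lambda (N : ModuleCat.{u} (Corner f)) (k : ℕ) :
    Subsingleton (Ext (ModuleCat.of (Corner f) (CornerSub f (lambdaE f))) N (k + 1)) := by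
  have : Module.Projective (Corner f) (CornerSub f (lambdaE f)) :=
    Module.Projective.of_equiv' (cornerLambda f).symm
  have : Projective (ModuleCat.of (Corner f) (CornerSub f (lambdaE f))) :=
    (IsProjective.iff_projective _).1 inferInstance
  exact Ext.subsingleton_of_projective _ _ _

theorem ext_projective (P : ModuleCat.{u} Λ) [Module.Projective Λ P] (N : ModuleCat.{u} Λ) (k : ℕ) :
    Subsingleton (Ext P N (k + 1)) := by
  have : Projective P := (IsProjective.iff_projective _).1 inferInstance
  exact Ext.subsingleton_of_projective _ _ _

theorem ext_corner_vanish {ι : Type*} [Fintype ι] {M : ModuleCat.{u} Λ} (A : ι → ModuleCat.{u} Λ)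
    (a : ∀ j, M →ₗ[Λ] A j) (b : ∀ j, A j →ₗ[Λ] M) (h : ∑ j, b j ∘ₗ a j = LinearMap.id)
    (N : ModuleCat.{u} (Corner f)) (n : ℕ)
    (hA : ∀ j, Subsingleton (Ext (ModuleCat.of (Corner f) (CornerSub f (A j))) N n)) :
    Subsingleton (Ext (ModuleCat.of (Corner f) (CornerSub f M)) N n) := by
  refine ext_vanish_of_sum (fun j => ModuleCat.of (Corner f) (CornerSub f (A j)))
    (fun j => cornerMap f (a j)) (fun j => cornerMap f (b j)) ?_ N n hA
  have := congrArg (cornerMapHom f M M) h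
  rw [map_sum] at this
  exact this

theorem ext_corner_proj {e : Λ} (hef : e + f = 1) (c : ℕ)
    (hpd : ∀ (N : ModuleCat.{u} (Corner f)) (k : ℕ), c < k →
      Subsingleton (Ext (ModuleCat.of (Corner f) (CornerSub f ↥(lambdaE e))) N k))
    (P : ModuleCat.{u} Λ) [Module.Projective Λ P] [Module.Finite Λ P]
    (N : ModuleCat.{u} (Corner f)) (k : ℕ) (hk : c < k) :
    Subsingleton (Ext (ModuleCat.of (Corner f) (CornerSub f P)) N k) := by
  obtain ⟨n, q, g, -, -, hqg⟩ := Module.Finite.exists_comp_eq_id_of_projective Λ P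
  refine ext_corner_vanish (ι := Fin n ⊕ Fin n)
    (Sum.elim (fun _ => ModuleCat.of Λ (lambdaE e)) (fun _ => ModuleCat.of Λ (lambdaE f)))
    (fun j => match j with
      | .inl j => mulR e ∘ₗ LinearMap.proj j ∘ₗ g
      | .inr j => mulR f ∘ₗ LinearMap.proj j ∘ₗ g)
    (fun j => match j with
      | .inl j => q ∘ₗ LinearMap.single Λ (fun _ => Λ) j ∘ₗ (lambdaE e).subtype
      | .inr j => q ∘ₗ LinearMap.single Λ (fun _ => Λ) j ∘ₗ (lambdaE f).subtype) ?_ N k ?_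
  · ext x
    rw [Fintype.sum_sum_type, ← Finset.sum_add_distrib]
    have h2 : ∀ j : Fin n, q (Pi.single j (g x j * e)) + q (Pi.single j (g x j * f))
        = q (Pi.single j (g x j)) := by
      intro j
      rw [← map_add, ← Pi.single_add, ← mul_add, hef, mul_one]
    rw [LinearMap.sum_apply]
    refine (Finset.sum_congr rfl fun j _ => h2 j).trans ?_
    rw [← map_sum, Finset.univ_sum_single]
    exact LinearMap.congr_fun hqg x
  · rintro (j | j)
    · exact hpd N k hk
    · obtain ⟨k, rfl⟩ := Nat.exists_eq_succ_of_ne_zero (Nat.ne_of_gt (Nat.zero_lt_of_lt hk))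
      exact ext_corner_lambda N k

end CornerTools

section Cover
variable {Λ : Type u} [Ring Λ]

theorem jacRad_eq : jacRad Λ = Module.jacobson Λ Λ := Ideal.jacobson_bot

theorem radQuot_semisimple [IsArtinianRing Λ] (ε : Λ) : IsSemisimpleModule Λ (radQuotPart Λ ε) := by
  have h : IsSemisimpleModule Λ (Λ ⧸ jacRad Λ) := by
    rw [IsArtinian.isSemisimpleModule_iff_jacobson, jacRad_eq]
    exact Module.jacobson_quotient_jacobson Λ Λ
  exact inferInstanceAs (IsSemisimpleModule Λ ↥(Submodule.map (jacRad Λ).mkQ (lambdaE ε)))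

theorem exists_cover [IsArtinianRing Λ] [IsNoetherianRing Λ] (Z : Type u) [AddCommGroup Z]
    [Module Λ Z] [Module.Finite Λ Z] :
    ∃ (P : ModuleCat.{u} Λ) (p : P →ₗ[Λ] Z), Module.Projective Λ P ∧ Module.Finite Λ P ∧
      Function.Surjective p ∧ ∀ (S : ModuleCat.{u} Λ), IsSemisimpleModule Λ S →
        ∀ g : P →ₗ[Λ] S, ∀ x, p x = 0 → g x = 0 := by
  obtain ⟨m, q, hq⟩ := Module.Finite.exists_fin' Λ Z
  obtain ⟨N, hN, hmin⟩ := IsArtinian.set_has_minimal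
    {N : Submodule Λ (Fin m → Λ) | N.map q = ⊤}
    ⟨⊤, by simpa [LinearMap.range_eq_top] using hq⟩
  have hN' : N.map q = ⊤ := hN
  have hmin' : ∀ I : Submodule Λ (Fin m → Λ), I ≤ N → I.map q = ⊤ → I = N := by
    intro I hI h
    by_contra hne
    exact hmin I h (lt_of_le_of_ne hI hne)
  let p : N →ₗ[Λ] Z := q ∘ₗ N.subtype
  have hp : Function.Surjective p := by
    intro z
    have : z ∈ N.map q := hN' ▸ Submodule.mem_top
    obtain ⟨x, hx, rfl⟩ := this
    exact ⟨⟨x, hx⟩, rfl⟩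
  obtain ⟨h, hh⟩ := Module.projective_lifting_property p q hp
  have hh' : ∀ x, q (h x).1 = q x := fun x => LinearMap.congr_fun hh x
  let k : N →ₗ[Λ] N := h ∘ₗ N.subtype
  have hk : Function.Surjective k := by
    have h1 : (LinearMap.range k).map N.subtype = N := by
      apply hmin'
      · exact Submodule.map_subtype_le _ _
      · rw [eq_top_iff]
        intro z _
        obtain ⟨x, rfl⟩ := hp z
        exact ⟨(k x).1, ⟨k x, ⟨x, rfl⟩, rfl⟩, hh' x.1⟩
    intro y
    have : y.1 ∈ (LinearMap.range k).map N.subtype := h1.symm ▸ y.2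
    obtain ⟨w, ⟨x, rfl⟩, hw⟩ := this
    exact ⟨x, Subtype.ext hw⟩
  have hb := IsNoetherian.bijective_of_surjective_endomorphism k hk
  let E := LinearEquiv.ofBijective k hb
  refine ⟨ModuleCat.of Λ N, p, ?_, ?_, hp, ?_⟩
  · refine Module.Projective.of_split N.subtype (E.symm.toLinearMap ∘ₗ h) ?_
    ext1 x
    exact E.symm_apply_apply x
  · exact inferInstanceAs (Module.Finite Λ N)
  · intro S hS g x hx
    change N →ₗ[Λ] S at g
    change N at x
    obtain ⟨W, hW⟩ := exists_isCompl ((LinearMap.ker p).map g)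
    have h1 : (W.comap g).map N.subtype = N := by
      apply hmin'
      · exact Submodule.map_subtype_le _ _
      · rw [eq_top_iff]
        intro z _
        obtain ⟨y, rfl⟩ := hp z
        have : g y ∈ (LinearMap.ker p).map g ⊔ W := hW.sup_eq_top ▸ Submodule.mem_top
        obtain ⟨a, ⟨t, ht, rfl⟩, w, hw, hsum⟩ := Submodule.mem_sup.1 this
        refine ⟨(y - t).1, ⟨y - t, ?_, rfl⟩, ?_⟩
        · change g (y - t) ∈ W
          rw [map_sub, ← hsum, add_sub_cancel_left]
          exact hw
        · change p (y - t) = p y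
          rw [map_sub, show p t = 0 from ht, sub_zero]
    have hxW : g x ∈ W := by
      have : x.1 ∈ (W.comap g).map N.subtype := h1.symm ▸ x.2
      obtain ⟨w, hw, hwx⟩ := this
      rw [← show w = x from Subtype.ext hwx]
      exact hw
    have hxK : g x ∈ (LinearMap.ker p).map g := ⟨x, hx, rfl⟩
    have := hW.disjoint.le_bot ⟨hxK, hxW⟩
    exact this

theorem span_top_of_hom [IsArtinianRing Λ] {e f : Λ} (hf : IsIdempotentElem f) (hef : e + f = 1)
    (Z : Type u) [AddCommGroup Z] [Module Λ Z] [Module.Finite Λ Z]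
    (h : ∀ g : Z →ₗ[Λ] radQuotPart Λ e, g = 0) :
    Submodule.span Λ {z : Z | f • z = z} = ⊤ := by
  have := radQuot_semisimple e
  rcases eq_top_or_exists_le_coatom (Submodule.span Λ {z : Z | f • z = z}) with h0 | ⟨W, hW, hle⟩
  · exact h0
  exfalso
  have hs : IsSimpleModule Λ (Z ⧸ W) := isSimpleModule_iff_isCoatom.2 hW
  obtain ⟨z, hz⟩ : ∃ z, z ∉ W := by
    by_contra hc
    push Not at hc
    exact hW.1 (eq_top_iff.2 fun z _ => hc z)
  have hfz : f • z ∈ W := hle (Submodule.subset_span (by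
    change f • f • z = f • z
    rw [smul_smul, hf.eq]))
  let t : Z ⧸ W := W.mkQ z
  have ht : t ≠ 0 := by
    intro h0
    exact hz ((Submodule.Quotient.mk_eq_zero W).1 h0)
  have het : e • t = t := by
    have h1 : f • t = 0 := by
      change f • W.mkQ z = 0
      rw [← map_smul]
      exact (Submodule.Quotient.mk_eq_zero W).2 hfz
    calc e • t = e • t + f • t := by rw [h1, add_zero]
      _ = t := by rw [← add_smul, hef, one_smul]
  have hker : jacRad Λ ≤ LinearMap.ker (LinearMap.toSpanSingleton Λ (Z ⧸ W) t) := by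
    intro r hr
    rw [jacRad_eq] at hr
    have := IsSemisimpleModule.jacobson_le_annihilator Λ (Z ⧸ W) hr
    rw [Module.mem_annihilator] at this
    exact this t
  let ψ : radQuotPart Λ e →ₗ[Λ] (Z ⧸ W) :=
    ((jacRad Λ).liftQ _ hker) ∘ₗ (Submodule.map (jacRad Λ).mkQ (lambdaE e)).subtype
  have hψ : ψ ≠ 0 := by
    intro h0
    have hm : (jacRad Λ).mkQ e ∈ Submodule.map (jacRad Λ).mkQ (lambdaE e) :=
      ⟨e, ⟨1, by simp⟩, rfl⟩
    have h1 : ψ ⟨_, hm⟩ = e • t := rfl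
    rw [h0, het] at h1
    exact ht h1.symm
  obtain ⟨σ, hσ⟩ := IsSemisimpleModule.lifting_property ψ (LinearMap.surjective_of_ne_zero hψ)
    W.mkQ
  rw [h σ] at hσ
  apply ht
  change W.mkQ z = 0
  rw [← hσ]
  simp

end Cover

section Good
variable {Λ : Type u} [Ring Λ] {f : Λ} [hf : Fact (IsIdempotentElem f)]

theorem radQuot_f_zero {e : Λ} (hsub : ∀ x : Λ, f * x * e ∈ jacRad Λ) (x : radQuotPart Λ e) :
    f • x = 0 := by
  obtain ⟨_, _, ⟨y, rfl⟩, rfl⟩ := x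
  apply Subtype.ext
  change (jacRad Λ).mkQ (f * (y * e)) = 0
  rw [← mul_assoc]
  exact (Submodule.Quotient.mk_eq_zero _).2 (hsub y)

/-- The generator of the `i`-th summand. -/
def epsGen (f : Λ) (ι : Type u) [DecidableEq ι] (i : ι) : ι → lambdaE f :=
  Pi.single i (⟨f, ⟨1, one_smul Λ f⟩⟩ : lambdaE f)

theorem epsGen_smul (ι : Type u) [DecidableEq ι] (i : ι) : f • epsGen f ι i = epsGen f ι i := by
  rw [epsGen, ← Pi.single_smul]
  congr 1
  exact Subtype.ext hf.out

theorem epsGen_sum (ι : Type u) [DecidableEq ι] [Fintype ι] (x : ι → lambdaE f) :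
    x = ∑ i, (x i).1 • epsGen f ι i := by
  have h : ∀ i, (x i).1 • epsGen f ι i = Pi.single i (x i) := by
    intro i
    rw [epsGen, ← Pi.single_smul]
    congr 1
    exact Subtype.ext (lambdaE_mul hf.out (x i))
  simp_rw [h]
  exact (Finset.univ_sum_single x).symm

/-- `(x_i) ↦ ∑ x_i • y_i` -/
def sumMap (f : Λ) {ι : Type u} [Fintype ι] {Y : Type u} [AddCommGroup Y] [Module Λ Y]
    (y : ι → Y) : (ι → lambdaE f) →ₗ[Λ] Y :=
  ∑ i, LinearMap.toSpanSingleton Λ Y (y i) ∘ₗ (lambdaE f).subtype ∘ₗ LinearMap.proj i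

theorem sumMap_apply {ι : Type u} [Fintype ι] {Y : Type u} [AddCommGroup Y] [Module Λ Y]
    (y : ι → Y) (x : ι → lambdaE f) : sumMap f y x = ∑ i, (x i).1 • y i := by
  rw [sumMap, LinearMap.sum_apply]
  rfl

theorem pi_lift (ι : Type u) [DecidableEq ι] [Fintype ι] {Y : Type u} [AddCommGroup Y] [Module Λ Y]
    (h : CornerSub f (ι → lambdaE f) →ₗ[Corner f] CornerSub f Y) :
    ∃ g : (ι → lambdaE f) →ₗ[Λ] Y, cornerMap f g = h := by
  let E : ι → CornerSub f (ι → lambdaE f) := fun i => ⟨epsGen f ι i, epsGen_smul ι i⟩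
  refine ⟨sumMap f fun i => (h (E i)).1, ?_⟩
  ext1 x
  apply cornerSub_ext
  refine (sumMap_apply _ _).trans ?_
  let a : ι → Corner f := fun i => ⟨(x.1 i).1, by
    change f * (x.1 i).1 * f = (x.1 i).1
    have h1 : f * (x.1 i).1 = (x.1 i).1 := congrArg Subtype.val (congrFun x.2 i)
    rw [h1, lambdaE_mul hf.out]⟩
  have hx : x = ∑ i, a i • E i := by
    apply cornerSub_ext
    rw [← cornerVal_apply, ← cornerVal_apply, map_sum]
    exact epsGen_sum ι x.1
  have h2 : (h x).1 = ∑ i, (a i • h (E i)).1 := by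
    conv_lhs => rw [hx]
    rw [map_sum, ← cornerVal_apply, map_sum]
    simp_rw [map_smul]
    rfl
  exact h2.symm

theorem cornerMap_inj_of_span {Z Y : Type u} [AddCommGroup Z] [Module Λ Z] [AddCommGroup Y]
    [Module Λ Y] (hZ : Submodule.span Λ {z : Z | f • z = z} = ⊤) (g g' : Z →ₗ[Λ] Y)
    (h : cornerMap f g = cornerMap f g') : g = g' := by
  refine LinearMap.ext_on hZ fun z hz => ?_
  exact congrArg Subtype.val (LinearMap.congr_fun h (⟨z, hz⟩ : CornerSub f Z))

variable [HasExt.{u} (ModuleCat.{u} Λ)] [HasExt.{u} (ModuleCat.{u} (Corner f))]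
open Abelian

theorem good_step [IsArtinianRing Λ] [IsNoetherianRing Λ] {e : Λ} (hef : e + f = 1)
    (hsub : ∀ x : Λ, f * x * e ∈ jacRad Λ)
    (Z : ModuleCat.{u} Λ) (hfin : Module.Finite Λ Z)
    (hZ : ∀ k, Subsingleton (Ext Z (radQuotPart Λ e) k)) :
    ∃ (K P : ModuleCat.{u} Λ) (i : K →ₗ[Λ] P) (p : P →ₗ[Λ] Z),
      Function.Injective i ∧ Function.Surjective p ∧ Function.Exact i p ∧
      Module.Finite Λ K ∧ (∀ k, Subsingleton (Ext K (radQuotPart Λ e) k)) ∧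
      (∀ Y k, Subsingleton (Ext P Y (k + 1))) ∧
      (∀ N k, Subsingleton (Ext (ModuleCat.of (Corner f) (CornerSub f P)) N (k + 1))) ∧
      (∀ (Y : ModuleCat.{u} Λ) (h : CornerSub f P →ₗ[Corner f] CornerSub f Y),
        ∃ g : P →ₗ[Λ] Y, cornerMap f g = h) := by
  classical
  have hspan := span_top_of_hom hf.out hef Z (fun g => ext_zero_hom (hZ 0) g)
  have hfg : (Submodule.span Λ {z : Z | f • z = z}).FG := by
    rw [hspan]
    exact hfin.fg_top
  obtain ⟨s, hs, hs'⟩ := (Submodule.fg_span_iff_fg_span_finset_subset _).1 hfg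
  rw [hspan] at hs'
  let ι : Type u := ↥s
  let P : ModuleCat.{u} Λ := ModuleCat.of Λ (ι → lambdaE f)
  let p : (ι → lambdaE f) →ₗ[Λ] Z := sumMap f fun i => i.1
  have hp : Function.Surjective p := by
    rw [← LinearMap.range_eq_top, eq_top_iff, hs', Submodule.span_le]
    intro z hz
    refine ⟨epsGen f ι ⟨z, hz⟩, ?_⟩
    refine (sumMap_apply _ _).trans ?_
    rw [Finset.sum_eq_single (⟨z, hz⟩ : ι)]
    · rw [epsGen, Pi.single_eq_same]
      exact hs hz
    · intro j _ hj
      rw [epsGen, Pi.single_eq_of_ne hj]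
      exact zero_smul Λ _
    · intro hc
      exact absurd (Finset.mem_univ _) hc
  have hproj : Module.Projective Λ (ι → lambdaE f) := by
    refine Module.Projective.of_split (M := ι → Λ)
      (LinearMap.pi fun i => (lambdaE f).subtype ∘ₗ LinearMap.proj i)
      (LinearMap.pi fun i => mulR f ∘ₗ LinearMap.proj i) ?_
    apply LinearMap.ext
    intro x
    funext i
    exact Subtype.ext (lambdaE_mul hf.out (x i))
  have hP0 : ∀ Y k, Subsingleton (Ext P Y (k + 1)) := by
    have : Module.Projective Λ P := hproj
    exact fun Y k => ext_projective P Y k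
  have hPS : ∀ k, Subsingleton (Ext P (radQuotPart Λ e) k) := by
    intro k
    cases k with
    | succ k => exact hP0 _ k
    | zero =>
      apply ext_zero_of_hom
      intro g
      apply LinearMap.ext
      intro x
      change (ι → lambdaE f) at x
      change g x = 0
      rw [epsGen_sum ι x]
      refine (map_sum g _ _).trans (Finset.sum_eq_zero fun i _ => ?_)
      refine (map_smul g _ _).trans ?_
      have h1 : g (epsGen f ι i) = 0 := by
        rw [← epsGen_smul ι i]
        exact (map_smul g _ _).trans (radQuot_f_zero hsub _)
      exact (congrArg _ h1).trans (smul_zero _)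
  let K : ModuleCat.{u} Λ := ModuleCat.of Λ (LinearMap.ker p)
  have hex : Function.Exact (LinearMap.ker p).subtype p := LinearMap.exact_subtype_ker_map p
  refine ⟨K, P, (LinearMap.ker p).subtype, p, Subtype.val_injective, hp, hex, ?_, ?_, hP0, ?_, ?_⟩
  · exact inferInstanceAs (Module.Finite Λ (LinearMap.ker p))
  · intro k
    obtain ⟨E⟩ := ext_shift_s14 (K := K) (P := P) (Z := Z) (LinearMap.ker p).subtype p
      Subtype.val_injective hp hex (radQuotPart Λ e) k (hPS k) (hPS (k + 1))
    have := hZ (k + 1)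
    exact E.toEquiv.subsingleton
  · intro N k
    refine ext_corner_vanish (ι := ι) (M := P) (fun _ => ModuleCat.of Λ (lambdaE f))
      (fun j => LinearMap.proj j) (fun j => LinearMap.single Λ (fun _ => lambdaE f) j) ?_ N (k + 1)
      (fun _ => ext_corner_lambda N k)
    apply LinearMap.ext
    intro x
    rw [LinearMap.sum_apply]
    exact Finset.univ_sum_single x
  · intro Y h
    exact pi_lift ι h

theorem good_hom_surj [IsArtinianRing Λ] [IsNoetherianRing Λ] {e : Λ} (hef : e + f = 1)
    (hsub : ∀ x : Λ, f * x * e ∈ jacRad Λ)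
    (Z : ModuleCat.{u} Λ) (hfin : Module.Finite Λ Z)
    (hZ : ∀ k, Subsingleton (Ext Z (radQuotPart Λ e) k)) (Y : ModuleCat.{u} Λ)
    (h : CornerSub f Z →ₗ[Corner f] CornerSub f Y) : ∃ g : Z →ₗ[Λ] Y, cornerMap f g = h := by
  obtain ⟨K, P, i, p, hi, hp, hex, hK, hKS, -, -, hlift⟩ := good_step hef hsub Z hfin hZ
  obtain ⟨k, hk⟩ := hlift Y (h ∘ₗ cornerMap f p)
  have hspan := span_top_of_hom hf.out hef K (fun g => ext_zero_hom (hKS 0) g)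
  have hki : k ∘ₗ i = 0 := by
    apply cornerMap_inj_of_span hspan
    rw [cornerMap_comp, hk, LinearMap.comp_assoc, ← cornerMap_comp, hex.linearMap_comp_eq_zero]
    ext1 x
    exact map_zero h
  have hle : LinearMap.ker p ≤ LinearMap.ker k := by
    intro x hx
    obtain ⟨y, rfl⟩ := (hex x).1 hx
    exact LinearMap.congr_fun hki y
  obtain ⟨g, hg⟩ : ∃ g : Z →ₗ[Λ] Y, g ∘ₗ p = k := by
    refine ⟨(LinearMap.ker p).liftQ k hle ∘ₗ (p.quotKerEquivOfSurjective hp).symm.toLinearMap, ?_⟩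
    ext1 x
    have : (p.quotKerEquivOfSurjective hp).symm (p x) = Submodule.Quotient.mk x := by
      rw [LinearEquiv.symm_apply_eq]
      rfl
    change (LinearMap.ker p).liftQ k hle ((p.quotKerEquivOfSurjective hp).symm (p x)) = k x
    rw [this]
    rfl
  refine ⟨g, ?_⟩
  rw [← hg, cornerMap_comp] at hk
  ext1 x
  obtain ⟨y, rfl⟩ := cornerMap_surj p hp x
  exact LinearMap.congr_fun hk y

theorem good_ext [IsArtinianRing Λ] [IsNoetherianRing Λ] {e : Λ} (hef : e + f = 1)
    (hsub : ∀ x : Λ, f * x * e ∈ jacRad Λ) (Y : ModuleCat.{u} Λ) (n : ℕ) :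
    ∀ (Z : ModuleCat.{u} Λ) (_ : Module.Finite Λ Z)
      (_ : ∀ k, Subsingleton (Ext Z (radQuotPart Λ e) k)),
      Nonempty (Ext Z Y (n + 1) ≃+ Ext (ModuleCat.of (Corner f) (CornerSub f Z))
        (ModuleCat.of (Corner f) (CornerSub f Y)) (n + 1)) := by
  induction n with
  | zero =>
    intro Z hfin hZ
    obtain ⟨K, P, i, p, hi, hp, hex, hK, hKS, hP, hFP, hlift⟩ := good_step hef hsub Z hfin hZ
    have hspan := span_top_of_hom hf.out hef K (fun g => ext_zero_hom (hKS 0) g)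
    obtain ⟨s, hs, hs'⟩ := ext_one i p hi hp hex Y (hP Y 0)
    obtain ⟨t, ht, ht'⟩ := ext_one (K := ModuleCat.of (Corner f) (CornerSub f K))
      (P := ModuleCat.of (Corner f) (CornerSub f P)) (Z := ModuleCat.of (Corner f) (CornerSub f Z))
      (cornerMap f i) (cornerMap f p) (cornerMap_inj i hi) (cornerMap_surj p hp)
      (cornerMap_exact i p hex) (ModuleCat.of (Corner f) (CornerSub f Y)) (hFP _ 0)
    refine addEquiv_of_surj (AddEquiv.ofBijective (cornerMapHom f K Y)
      ⟨fun a b hab => cornerMap_inj_of_span hspan a b hab,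
        fun h => good_hom_surj hef hsub K hK hKS Y h⟩) s t hs ht ?_
    intro a
    rw [hs']
    refine Iff.trans ?_ (ht' (cornerMap f a)).symm
    constructor
    · rintro ⟨k, rfl⟩
      exact ⟨cornerMap f k, rfl⟩
    · rintro ⟨k, hk⟩
      obtain ⟨g, rfl⟩ := hlift Y k
      exact ⟨g, cornerMap_inj_of_span hspan _ _ hk⟩
  | succ n ih =>
    intro Z hfin hZ
    obtain ⟨K, P, i, p, hi, hp, hex, hK, hKS, hP, hFP, hlift⟩ := good_step hef hsub Z hfin hZ
    obtain ⟨E1⟩ := ext_shift_s14 i p hi hp hex Y (n + 1) (hP _ _) (hP _ _)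
    obtain ⟨E2⟩ := ext_shift_s14 (K := ModuleCat.of (Corner f) (CornerSub f K))
      (P := ModuleCat.of (Corner f) (CornerSub f P)) (Z := ModuleCat.of (Corner f) (CornerSub f Z))
      (cornerMap f i) (cornerMap f p) (cornerMap_inj i hi) (cornerMap_surj p hp)
      (cornerMap_exact i p hex) (ModuleCat.of (Corner f) (CornerSub f Y)) (n + 1) (hFP _ _) (hFP _ _)
    obtain ⟨E3⟩ := ih K hK hKS
    exact ⟨E1.symm.trans (E3.trans E2)⟩

theorem main_shift [IsArtinianRing Λ] [IsNoetherianRing Λ] {e : Λ} (hef : e + f = 1)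
    (hsub : ∀ x : Λ, f * x * e ∈ jacRad Λ) (c : ℕ)
    (hpd : ∀ (N : ModuleCat.{u} (Corner f)) (k : ℕ), c < k →
      Subsingleton (Ext (ModuleCat.of (Corner f) (CornerSub f ↥(lambdaE e))) N k))
    (Y : ModuleCat.{u} Λ) (d : ℕ) :
    ∀ (Z : ModuleCat.{u} Λ) (_ : Module.Finite Λ Z)
      (_ : ∀ k, d < k → Subsingleton (Ext Z (radQuotPart Λ e) k)) (n : ℕ), d + c + 1 ≤ n →
      Nonempty (Ext Z Y (n + 1) ≃+ Ext (ModuleCat.of (Corner f) (CornerSub f Z))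
        (ModuleCat.of (Corner f) (CornerSub f Y)) (n + 1)) := by
  induction d with
  | zero =>
    intro Z hfin hZ n hn
    obtain ⟨P, p, hPp, hPf, hp, hP⟩ := exists_cover (Λ := Λ) Z
    let K : ModuleCat.{u} Λ := ModuleCat.of Λ (LinearMap.ker p)
    have hi : Function.Injective (LinearMap.ker p).subtype := Subtype.val_injective
    have hex : Function.Exact (LinearMap.ker p).subtype p := LinearMap.exact_subtype_ker_map p
    have hK : Module.Finite Λ K := inferInstanceAs (Module.Finite Λ (LinearMap.ker p))
    have hKS : ∀ k, Subsingleton (Ext K (radQuotPart Λ e) k) := by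
      intro k
      cases k with
      | zero =>
        apply ext_zero_of_hom
        intro g
        obtain ⟨δ, -, hδ⟩ := ext_one (K := K) (P := P) (Z := Z) (LinearMap.ker p).subtype p hi hp
          hex (radQuotPart Λ e) (ext_projective P _ 0)
        have := hZ 1 Nat.zero_lt_one
        obtain ⟨k, rfl⟩ := (hδ g).1 (this.elim _ _)
        apply LinearMap.ext
        intro x
        exact hP _ (radQuot_semisimple e) k x.1 x.2
      | succ k =>
        obtain ⟨E⟩ := ext_shift_s14 (K := K) (P := P) (Z := Z) (LinearMap.ker p).subtype p
          hi hp hex (radQuotPart Λ e) (k + 1) (ext_projective P _ k) (ext_projective P _ _)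
        have := hZ (k + 1 + 1) (Nat.succ_pos _)
        exact E.toEquiv.subsingleton
    obtain ⟨m, rfl⟩ : ∃ m, n = m + 1 := ⟨n - 1, by omega⟩
    obtain ⟨E1⟩ := ext_shift_s14 (K := K) (P := P) (Z := Z) (LinearMap.ker p).subtype p
      hi hp hex Y (m + 1) (ext_projective P _ _) (ext_projective P _ _)
    obtain ⟨E2⟩ := ext_shift_s14 (K := ModuleCat.of (Corner f) (CornerSub f K))
      (P := ModuleCat.of (Corner f) (CornerSub f P)) (Z := ModuleCat.of (Corner f) (CornerSub f Z))
      (cornerMap f (LinearMap.ker p).subtype) (cornerMap f p) (cornerMap_inj _ hi)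
      (cornerMap_surj p hp)
      (cornerMap_exact _ p hex) (ModuleCat.of (Corner f) (CornerSub f Y)) (m + 1)
      (ext_corner_proj hef c hpd P _ _ (by omega)) (ext_corner_proj hef c hpd P _ _ (by omega))
    obtain ⟨E3⟩ := good_ext hef hsub Y m K hK hKS
    exact ⟨E1.symm.trans (E3.trans E2)⟩
  | succ d ih =>
    intro Z hfin hZ n hn
    obtain ⟨P, p, hPp, hPf, hp, hP⟩ := exists_cover (Λ := Λ) Z
    let K : ModuleCat.{u} Λ := ModuleCat.of Λ (LinearMap.ker p)
    have hi : Function.Injective (LinearMap.ker p).subtype := Subtype.val_injective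
    have hex : Function.Exact (LinearMap.ker p).subtype p := LinearMap.exact_subtype_ker_map p
    have hK : Module.Finite Λ K := inferInstanceAs (Module.Finite Λ (LinearMap.ker p))
    have hKS : ∀ k, d < k → Subsingleton (Ext K (radQuotPart Λ e) k) := by
      intro k hk
      obtain ⟨k, rfl⟩ : ∃ m, k = m + 1 := ⟨k - 1, by omega⟩
      obtain ⟨E⟩ := ext_shift_s14 (K := K) (P := P) (Z := Z) (LinearMap.ker p).subtype p
        hi hp hex (radQuotPart Λ e) (k + 1) (ext_projective P _ k) (ext_projective P _ _)
      have := hZ (k + 1 + 1) (by omega)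
      exact E.toEquiv.subsingleton
    obtain ⟨m, rfl⟩ : ∃ m, n = m + 1 := ⟨n - 1, by omega⟩
    obtain ⟨E1⟩ := ext_shift_s14 (K := K) (P := P) (Z := Z) (LinearMap.ker p).subtype p
      hi hp hex Y (m + 1) (ext_projective P _ _) (ext_projective P _ _)
    obtain ⟨E2⟩ := ext_shift_s14 (K := ModuleCat.of (Corner f) (CornerSub f K))
      (P := ModuleCat.of (Corner f) (CornerSub f P)) (Z := ModuleCat.of (Corner f) (CornerSub f Z))
      (cornerMap f (LinearMap.ker p).subtype) (cornerMap f p) (cornerMap_inj _ hi)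
      (cornerMap_surj p hp)
      (cornerMap_exact _ p hex) (ModuleCat.of (Corner f) (CornerSub f Y)) (m + 1)
      (ext_corner_proj hef c hpd P _ _ (by omega)) (ext_corner_proj hef c hpd P _ _ (by omega))
    obtain ⟨E3⟩ := ih K hK hKS m (by omega)
    exact ⟨E1.symm.trans (E3.trans E2)⟩

end Good

theorem star_equiv {Λ : Type u} [Ring Λ] (f : Λ) [hf : Fact (IsIdempotentElem f)] :
    Nonempty (CornerSub f (radQuotPart Λ f) ≃ₗ[Corner f] (Corner f ⧸ rStar f)) := by
  let φ : Corner f →ₗ[Corner f] CornerSub f (radQuotPart Λ f) :=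
    { toFun := fun x => ⟨⟨(jacRad Λ).mkQ x.1, ⟨x.1, ⟨x.1, Corner.absorb_right x.2⟩, rfl⟩⟩, by
        apply Subtype.ext
        change (jacRad Λ).mkQ (f * x.1) = (jacRad Λ).mkQ x.1
        rw [Corner.absorb_left x.2]⟩
      map_add' := fun _ _ => rfl
      map_smul' := fun _ _ => rfl }
  have hker : LinearMap.ker φ = rStar f := by
    ext x
    constructor
    · intro hx
      have h1 : (jacRad Λ).mkQ x.1 = 0 := congrArg (fun y => y.1.1) (show φ x = 0 from hx)
      exact (Submodule.Quotient.mk_eq_zero (jacRad Λ)).1 h1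
    · intro hx
      have h1 : (jacRad Λ).mkQ x.1 = 0 := (Submodule.Quotient.mk_eq_zero (jacRad Λ)).2 hx
      exact cornerSub_ext (Subtype.ext h1)
  have hsurj : Function.Surjective φ := by
    rintro ⟨⟨_, _, ⟨y, rfl⟩, rfl⟩, hy⟩
    have hy' : (jacRad Λ).mkQ (f * (y * f)) = (jacRad Λ).mkQ (y * f) := congrArg Subtype.val hy
    refine ⟨⟨f * y * f, ?_⟩, cornerSub_ext (Subtype.ext ?_)⟩
    · change f * (f * y * f) * f = f * y * f
      simp only [mul_assoc, hf.out.eq]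
      simp only [← mul_assoc, hf.out.eq]
    · change (jacRad Λ).mkQ (f * y * f) = (jacRad Λ).mkQ (y * f)
      rw [mul_assoc, hy']
  exact ⟨(φ.quotKerEquivOfSurjective hsurj).symm.trans (Submodule.quotEquivOfEq _ _ hker)⟩

theorem ext_comparison_for_modules
    {Λ : Type u} [Ring Λ]
    (C : Type u) [CommRing C] [IsArtinianRing C] [Algebra C Λ] [Module.Finite C Λ]
    (e : Λ) [he : Fact (IsIdempotentElem e)]
    [HasExt.{u} (ModuleCat.{u} Λ)] [HasExt.{u} (ModuleCat.{u} (Corner (1 - e)))]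
    (hsub : ∀ x : Λ, (1 - e) * x * e ∈ jacRad Λ)
    (b c : ℕ)
    (hpd : ∀ (N : ModuleCat.{u} (Corner (1 - e))) (k : ℕ), c < k →
      Subsingleton (Abelian.Ext
        (ModuleCat.of (Corner (1 - e)) (CornerSub (1 - e) ↥(lambdaE e))) N k))
    (hid : ∀ (N : ModuleCat.{u} Λ) (k : ℕ), b < k →
      Subsingleton (Abelian.Ext N (radQuotPart Λ e) k)) :
    ∀ (X : ModuleCat.{u} Λ), Module.Finite Λ X →
      ∀ n : ℕ, b + c + 2 < n →
        Nonempty (Abelian.Ext X (radQuotPart Λ (1 - e)) n ≃+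
          Abelian.Ext (ModuleCat.of (Corner (1 - e)) (CornerSub (1 - e) X))
            (starSemisimpleQuot (1 - e)) n) := by
  intro X hX n hn
  have hart : IsArtinianRing Λ := IsArtinianRing.of_finite C Λ
  have hnoe : IsNoetherianRing Λ := IsNoetherianRing.of_finite C Λ
  obtain ⟨m, rfl⟩ : ∃ m, n = m + 1 := ⟨n - 1, by omega⟩
  obtain ⟨E1⟩ := main_shift (f := 1 - e) (e := e) (add_sub_cancel e 1) hsub c hpd
    (radQuotPart Λ (1 - e)) b X hX (fun k hk => hid X k hk) m (by omega)
  obtain ⟨E⟩ := star_equiv (1 - e)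
  obtain ⟨E2⟩ := ext_equiv_of_linearEquiv
    (Y := ModuleCat.of (Corner (1 - e)) (CornerSub (1 - e) X))
    (M := ModuleCat.of (Corner (1 - e)) (CornerSub (1 - e) (radQuotPart Λ (1 - e))))
    (N := starSemisimpleQuot (1 - e)) E (m + 1)
  exact ⟨E1.trans E2⟩
end

section
/- Let Λ be an Artin algebra with radical r, (e, f) complementary idempotents with fΛe ⊆ r, and Λ* = fΛf with r* = frf. Assume pd_{Λ*}(fΛe) = c < ∞, pd_Λ((Λ/r)e) = a < ∞, and id_Λ((Λ/r)e) = b < ∞. Then for all n > max{a, b+c+2} there are isomorphisms Ext^n_Λ(Λ/r, Λ/r) ≅ Ext^n_{Λ*}(Λ*/r*, Λ*/r*) that assemble into an isomorphism of graded rings without identity ⊕_{n > max{a,b+c+2}} Ext^n_Λ(Λ/r, Λ/r) ≅ ⊕_{n > max{a,b+c+2}} Ext^n_{Λ*}(Λ*/r*, Λ*/r*) with multiplication given by the Yoneda product. -/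
/-! STATEMENT 15: Let `Λ` be an Artin algebra with radical `r`, `(e, f)` a suitable
idempotent pair, `Λ* = fΛf` with radical `r* = frf`.  Assume `pd_{Λ*}(fΛe) = c < ∞`,
`pd_Λ((Λ/r)e) = a < ∞` and `id_Λ((Λ/r)e) = b < ∞`.  Then for all `n > max{a, b+c+2}`
there are isomorphisms `Ext^n_Λ(Λ/r, Λ/r) ≅ Ext^n_{Λ*}(Λ*/r*, Λ*/r*)` assembling into an
isomorphism of graded rings without identity (compatible with the Yoneda product). -/

universe u

open CategoryTheory

section AbsExt

set_option linter.unusedSectionVars false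

open CategoryTheory Limits Abelian

universe w1 w2 v1 v2 u1 u2

theorem isIso3_of_ses {C : Type u1} [Category.{v1} C] [Abelian C] {S T : ShortComplex C}
    (φ : S ⟶ T) (hS : S.ShortExact) (hT : T.ShortExact) [IsIso φ.τ₁] [IsIso φ.τ₂] :
    IsIso φ.τ₃ := by
  have := hS.epi_g
  have := hT.epi_g
  have hk : T.f ≫ inv φ.τ₂ ≫ S.g = 0 := by
    rw [← cancel_epi φ.τ₁, φ.comm₁₂_assoc]; simp
  have e : T.g ≫ hT.exact.desc (inv φ.τ₂ ≫ S.g) hk = inv φ.τ₂ ≫ S.g := hT.exact.g_desc _ _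
  refine ⟨hT.exact.desc (inv φ.τ₂ ≫ S.g) hk, ?_, ?_⟩
  · rw [← cancel_epi S.g, ← φ.comm₂₃_assoc, e]; simp
  · rw [← cancel_epi T.g, reassoc_of% e, ← φ.comm₂₃]; simp

variable {A : Type u1} [Category.{v1} A] [Abelian A] {B : Type u2} [Category.{v2} B] [Abelian B]
  [HasExt.{w1} A] [HasExt.{w2} B]
  (F : A ⥤ B) [F.Additive] [PreservesFiniteLimits F] [PreservesFiniteColimits F]

/-- bijectivity of the comparison map -/
def BijAt (M N : A) (n : ℕ) : Prop :=
  Function.Bijective (Ext.mapExactFunctor F : Ext.{w1} M N n → Ext.{w2} (F.obj M) (F.obj N) n)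

theorem postcomp_iso_bij {C : Type u1} [Category.{v1} C] [Abelian C] [HasExt.{w1} C]
    (M : C) {N N' : C} (g : N ⟶ N') [IsIso g] (n : ℕ) :
    Function.Bijective (fun x : Ext.{w1} M N n => x.comp (Ext.mk₀ g) (add_zero n)) := by
  constructor
  · intro x y h
    have := congrArg (fun z => Ext.comp z (Ext.mk₀ (inv g)) (add_zero n)) h
    simpa using this
  · intro y
    exact ⟨y.comp (Ext.mk₀ (inv g)) (add_zero n), by simp⟩

theorem bijAt_of_postcomp {M N N' : A} (g : N ⟶ N') (n : ℕ) [IsIso (F.map g)]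
    (hg : Function.Bijective (fun x : Ext.{w1} M N n => x.comp (Ext.mk₀ g) (add_zero n)))
    (h : BijAt.{w1, w2} F M N' n) : BijAt.{w1, w2} F M N n := by
  have hF := postcomp_iso_bij.{w2} (F.obj M) (F.map g) n
  have key : (fun x : Ext.{w2} (F.obj M) (F.obj N) n =>
        x.comp (Ext.mk₀ (F.map g)) (add_zero n)) ∘ Ext.mapExactFunctor F =
      Ext.mapExactFunctor F ∘ (fun x : Ext.{w1} M N n => x.comp (Ext.mk₀ g) (add_zero n)) := by
    funext x
    simp [Ext.mapExactFunctor_comp, Ext.mapExactFunctor_mk₀]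
  have h2 := h.comp hg
  unfold BijAt at *
  rw [← key] at h2
  exact (Function.Bijective.of_comp_iff' hF _).1 h2

theorem postcomp_epi_bij (b : ℕ)
    (hT : ∀ K : A, IsZero (F.obj K) → ∀ (M : A) (k : ℕ), b < k → Subsingleton (Ext.{w1} M K k))
    (M : A) {N N' : A} (g : N ⟶ N') [Epi g] [IsIso (F.map g)] (n : ℕ) (hn : b < n) :
    Function.Bijective (fun x : Ext.{w1} M N n => x.comp (Ext.mk₀ g) (add_zero n)) := by
  let S := ShortComplex.mk (kernel.ι g) g (kernel.condition g)
  have hS : S.ShortExact :=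
    { exact := ShortComplex.exact_kernel g
      mono_f := by dsimp [S]; infer_instance
      epi_g := by dsimp [S]; infer_instance }
  have hz : IsZero (F.obj (kernel g)) := by
    have h0 : F.map (kernel.ι g) = 0 := by
      rw [← cancel_mono (F.map g), ← F.map_comp, kernel.condition]; simp
    exact IsZero.of_mono_eq_zero _ h0
  constructor
  · suffices Function.Injective ((Ext.mk₀ g).postcomp M (add_zero n)) from this
    rw [injective_iff_map_eq_zero]
    intro x hx
    obtain ⟨y, rfl⟩ := Ext.covariant_sequence_exact₂ M hS x hx
    have := hT _ hz M n hn
    rw [Subsingleton.elim y 0]; simp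
  · intro y
    have := hT _ hz M (n+1) (by lia)
    exact Ext.covariant_sequence_exact₃ M hS y rfl (Subsingleton.elim (α := Ext M (kernel g) (n+1)) _ _)

theorem postcomp_mono_bij (b : ℕ)
    (hT : ∀ K : A, IsZero (F.obj K) → ∀ (M : A) (k : ℕ), b < k → Subsingleton (Ext.{w1} M K k))
    (M : A) {N N' : A} (g : N ⟶ N') [Mono g] [IsIso (F.map g)] (n : ℕ) (hn : b + 1 < n) :
    Function.Bijective (fun x : Ext.{w1} M N n => x.comp (Ext.mk₀ g) (add_zero n)) := by
  let S := ShortComplex.mk g (cokernel.π g) (cokernel.condition g)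
  have hS : S.ShortExact :=
    { exact := ShortComplex.exact_cokernel g
      mono_f := by dsimp [S]; infer_instance
      epi_g := by dsimp [S]; infer_instance }
  have hz : IsZero (F.obj (cokernel g)) := by
    have h0 : F.map (cokernel.π g) = 0 := by
      rw [← cancel_epi (F.map g), ← F.map_comp, cokernel.condition]; simp
    exact IsZero.of_epi_eq_zero _ h0
  obtain ⟨m, rfl⟩ : ∃ m, n = m + 1 := ⟨n - 1, by lia⟩
  constructor
  · suffices Function.Injective ((Ext.mk₀ g).postcomp M (add_zero (m+1))) from this
    rw [injective_iff_map_eq_zero]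
    intro x hx
    obtain ⟨y, rfl⟩ := Ext.covariant_sequence_exact₁ M hS x hx rfl
    have := hT _ hz M m (by lia)
    rw [Subsingleton.elim (α := Ext M (cokernel g) m) y 0]; simp
  · intro y
    have := hT _ hz M (m+1) (by lia)
    exact Ext.covariant_sequence_exact₂ M hS y (Subsingleton.elim (α := Ext M (cokernel g) (m+1)) _ _)

theorem bijAt_of_iso (b : ℕ)
    (hT : ∀ K : A, IsZero (F.obj K) → ∀ (M : A) (k : ℕ), b < k → Subsingleton (Ext.{w1} M K k))
    {M N N' : A} (g : N ⟶ N') [IsIso (F.map g)] (n : ℕ) (hn : b + 1 < n)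
    (h : BijAt.{w1, w2} F M N' n) : BijAt.{w1, w2} F M N n := by
  have hfac : F.map (factorThruImage g) ≫ F.map (Limits.image.ι g) = F.map g := by
    rw [← F.map_comp, Limits.image.fac]
  have : Mono (F.map (factorThruImage g)) := by
    have : Mono (F.map (factorThruImage g) ≫ F.map (Limits.image.ι g)) := by
      rw [hfac]; infer_instance
    exact mono_of_mono _ (F.map (Limits.image.ι g))
  have : IsIso (F.map (factorThruImage g)) := isIso_of_mono_of_epi _
  have : Epi (F.map (Limits.image.ι g)) := by
    have : Epi (F.map (factorThruImage g) ≫ F.map (Limits.image.ι g)) := by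
      rw [hfac]; infer_instance
    exact epi_of_epi (F.map (factorThruImage g)) _
  have : IsIso (F.map (Limits.image.ι g)) := isIso_of_mono_of_epi _
  exact bijAt_of_postcomp F (factorThruImage g) n
    (postcomp_epi_bij.{w1} F b hT M _ n (by lia))
    (bijAt_of_postcomp F (Limits.image.ι g) n (postcomp_mono_bij.{w1} F b hT M _ n hn) h)

theorem postcomp_ext_bij {C : Type u1} [Category.{v1} C] [Abelian C] [HasExt.{w1} C]
    {S : ShortComplex C} (hS : S.ShortExact) (M : C) (n : ℕ) (hn : 0 < n)
    (h0 : ∀ k : ℕ, 0 < k → Subsingleton (Ext.{w1} M S.X₂ k)) :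
    Function.Bijective (fun x : Ext.{w1} M S.X₃ n => x.comp hS.extClass (rfl : n + 1 = n + 1)) := by
  constructor
  · suffices Function.Injective (hS.extClass.postcomp M (rfl : n + 1 = n + 1)) from this
    rw [injective_iff_map_eq_zero]
    intro x hx
    obtain ⟨y, rfl⟩ := Ext.covariant_sequence_exact₃ M hS x rfl hx
    have := h0 n hn
    rw [Subsingleton.elim y 0]; simp
  · intro y
    have := h0 (n+1) (by lia)
    exact Ext.covariant_sequence_exact₁ M hS y (Subsingleton.elim _ _) rfl

theorem bijAt_shift {S : ShortComplex A} (hS : S.ShortExact) (M : A)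
    (h0 : ∀ k : ℕ, 0 < k → Subsingleton (Ext.{w1} M S.X₂ k))
    (h0' : ∀ k : ℕ, 0 < k → Subsingleton (Ext.{w2} (F.obj M) (F.obj S.X₂) k))
    (n : ℕ) (hn : 0 < n) (h : BijAt.{w1, w2} F M S.X₃ n) : BijAt.{w1, w2} F M S.X₁ (n + 1) := by
  have h1 := postcomp_ext_bij.{w1} hS M n hn h0
  have h2 := postcomp_ext_bij.{w2} (hS.map_of_exact F) (F.obj M) n hn h0'
  have key : (fun x : Ext.{w2} (F.obj M) (F.obj S.X₃) n =>
        x.comp (hS.map_of_exact F).extClass (rfl : n + 1 = n + 1)) ∘ Ext.mapExactFunctor F =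
      Ext.mapExactFunctor F ∘
        (fun x : Ext.{w1} M S.X₃ n => x.comp hS.extClass (rfl : n + 1 = n + 1)) := by
    funext x
    simp only [Function.comp, Ext.mapExactFunctor_comp, Ext.mapExactFunctor_extClass]
    rfl
  have h3 := h2.comp h
  unfold BijAt at *
  erw [key] at h3
  exact (Function.Bijective.of_comp_iff _ h1).1 h3

theorem bijAt_shift_zero {S : ShortComplex A} (hS : S.ShortExact) (M : A)
    (h0 : Subsingleton (Ext.{w1} M S.X₂ 1))
    (h0' : Subsingleton (Ext.{w2} (F.obj M) (F.obj S.X₂) 1))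
    (hb2 : BijAt.{w1, w2} F M S.X₂ 0)
    (h : BijAt.{w1, w2} F M S.X₃ 0) : BijAt.{w1, w2} F M S.X₁ 1 := by
  constructor
  · suffices Function.Injective (F.mapExtAddHom M S.X₁ 1) from this
    rw [injective_iff_map_eq_zero]
    intro x hx
    obtain ⟨y, rfl⟩ := Ext.covariant_sequence_exact₁ M hS x (Subsingleton.elim _ _) (zero_add 1)
    rw [Functor.mapExtAddHom_apply, Ext.mapExactFunctor_comp, Ext.mapExactFunctor_extClass] at hx
    obtain ⟨z, hz⟩ := Ext.covariant_sequence_exact₃ (F.obj M) (hS.map_of_exact F) _ _ hx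
    obtain ⟨z, rfl⟩ := hb2.2 z
    have : z.comp (Ext.mk₀ S.g) (add_zero 0) = y := by
      apply h.1
      rw [Ext.mapExactFunctor_comp, Ext.mapExactFunctor_mk₀]
      exact hz
    rw [← this]
    simp
  · intro y
    obtain ⟨z, rfl⟩ := Ext.covariant_sequence_exact₁ (F.obj M) (hS.map_of_exact F) y
      (h0'.elim _ _) (zero_add 1)
    obtain ⟨z, rfl⟩ := h.2 z
    exact ⟨z.comp hS.extClass (zero_add 1), by
      rw [Ext.mapExactFunctor_comp, Ext.mapExactFunctor_extClass]; rfl⟩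

variable {H : B ⥤ A} (adj : F ⊣ H) [IsIso adj.counit]

include adj in
theorem bijAt_zero (M : A) (Y : B) : BijAt.{w1, w2} F M (H.obj Y) 0 := by
  unfold BijAt
  rw [Ext.mapExactFunctor₀]
  refine Ext.homEquiv₀.symm.bijective.comp (Function.Bijective.comp ?_ Ext.homEquiv₀.bijective)
  have h1 : Function.Bijective (fun g : F.obj M ⟶ F.obj (H.obj Y) => g ≫ adj.counit.app Y) := by
    constructor
    · intro x y h
      exact (cancel_mono (adj.counit.app Y)).1 h
    · intro y
      exact ⟨y ≫ inv (adj.counit.app Y), by simp⟩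
  have h2 : (fun g : F.obj M ⟶ F.obj (H.obj Y) => g ≫ adj.counit.app Y) ∘
      (fun g : M ⟶ H.obj Y => F.map g) = (adj.homEquiv M Y).symm := by
    funext g
    simp [Adjunction.homEquiv_counit]
  refine (Function.Bijective.of_comp_iff' h1 _).1 ?_
  rw [h2]
  exact (adj.homEquiv M Y).symm.bijective

theorem inj_ext {C : Type u1} [Category.{v1} C] [Abelian C] [HasExt.{w1} C] (M I : C) [Injective I]
    (k : ℕ) (hk : 0 < k) : Subsingleton (Ext.{w1} M I k) :=
  HasInjectiveDimensionLT.subsingleton I 1 k hk M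

variable [EnoughInjectives B]

include adj in
theorem bijAt_H (b : ℕ)
    (hT : ∀ K : A, IsZero (F.obj K) → ∀ (M : A) (k : ℕ), b < k → Subsingleton (Ext.{w1} M K k))
    (V : ℕ → B → Prop)
    (hV0 : ∀ S : ShortComplex B, S.ShortExact → Injective S.X₂ → V 0 S.X₁ →
      V 0 S.X₃ ∧ Epi (H.map S.g))
    (hV1 : ∀ d, ∀ S : ShortComplex B, S.ShortExact → Injective S.X₂ → V (d+1) S.X₁ →
      V d S.X₃)
    (d : ℕ) (Y : B) (hY : V d Y) (M : A) (n : ℕ) (hn : b + d + 1 < n) :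
    BijAt.{w1, w2} F M (H.obj Y) n := by
  have : PreservesLimits H := adj.rightAdjoint_preservesLimits
  have hHinj : ∀ J : B, Injective J → Injective (H.obj J) := fun J hJ => adj.map_injective J hJ
  have hFHinj : ∀ J : B, Injective J → Injective (F.obj (H.obj J)) := fun J hJ =>
    Injective.of_iso (asIso (adj.counit.app J)).symm hJ
  induction d generalizing Y n with
  | zero =>
    clear hn
    induction n generalizing Y with
    | zero => exact bijAt_zero F adj M Y
    | succ n ih =>
      let S := ShortComplex.mk (Injective.ι Y) (cokernel.π (Injective.ι Y)) (cokernel.condition _)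
      have hS : S.ShortExact :=
        { exact := ShortComplex.exact_cokernel _
          mono_f := by dsimp [S]; infer_instance
          epi_g := by dsimp [S]; infer_instance }
      have hJ : Injective S.X₂ := by dsimp [S]; infer_instance
      obtain ⟨hV', hepi⟩ := hV0 S hS hJ hY
      have hHS : (S.map H).ShortExact :=
        { exact := hS.exact.map_of_mono_of_preservesKernel H hS.mono_f inferInstance
          mono_f := by have := hS.mono_f; exact inferInstanceAs (Mono (H.map S.f))
          epi_g := hepi }
      have i1 : Injective (S.map H).X₂ := hHinj _ hJ
      have i2 : Injective (F.obj (S.map H).X₂) := hFHinj _ hJ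
      rcases Nat.eq_zero_or_pos n with rfl | hn
      · exact bijAt_shift_zero F hHS M (inj_ext _ _ _ one_pos) (inj_ext _ _ _ one_pos)
          (bijAt_zero F adj M _) (bijAt_zero F adj M _)
      · exact bijAt_shift F hHS M (fun k hk => inj_ext _ _ _ hk) (fun k hk => inj_ext _ _ _ hk) n hn
          (ih _ hV')
  | succ d ih =>
    let S := ShortComplex.mk (Injective.ι Y) (cokernel.π (Injective.ι Y)) (cokernel.condition _)
    have hS : S.ShortExact :=
      { exact := ShortComplex.exact_cokernel _
        mono_f := by dsimp [S]; infer_instance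
        epi_g := by dsimp [S]; infer_instance }
    have hJ : Injective S.X₂ := by dsimp [S]; infer_instance
    have hV' := hV1 d S hS hJ hY
    obtain ⟨n, rfl⟩ : ∃ m, n = m + 1 := ⟨n - 1, by lia⟩
    let T := ShortComplex.mk (H.map S.f) (cokernel.π (H.map S.f)) (cokernel.condition _)
    have hm : Mono (H.map S.f) := by have := hS.mono_f; infer_instance
    have hTS : T.ShortExact :=
      { exact := ShortComplex.exact_cokernel _
        mono_f := hm
        epi_g := by dsimp [T]; infer_instance }
    have i1 : Injective T.X₂ := hHinj _ hJ
    have i2 : Injective (F.obj T.X₂) := hFHinj _ hJ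
    let g : T.X₃ ⟶ H.obj S.X₃ := cokernel.desc (H.map S.f) (H.map S.g)
      (by rw [← H.map_comp, S.zero, H.map_zero])
    have hg : T.g ≫ g = H.map S.g := cokernel.π_desc _ _ _
    have : IsIso (F.map g) := by
      have hFT := hTS.map_of_exact F
      have e1 : F.map (H.map S.f) ≫ adj.counit.app S.X₂ = adj.counit.app S.X₁ ≫ S.f := by simp
      have e2 : F.map T.g ≫ F.map g ≫ adj.counit.app S.X₃ = adj.counit.app S.X₂ ≫ S.g := by
        rw [← Category.assoc, ← F.map_comp, hg]; simp
      let φ : T.map F ⟶ S :=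
        { τ₁ := adj.counit.app S.X₁
          τ₂ := adj.counit.app S.X₂
          τ₃ := F.map g ≫ adj.counit.app S.X₃
          comm₁₂ := e1.symm
          comm₂₃ := e2.symm }
      have h1 : IsIso φ.τ₁ := inferInstanceAs (IsIso (adj.counit.app S.X₁))
      have h2 : IsIso φ.τ₂ := inferInstanceAs (IsIso (adj.counit.app S.X₂))
      have h3 : IsIso (F.map g ≫ adj.counit.app S.X₃) :=
        isIso3_of_ses φ hFT hS
      exact IsIso.of_isIso_comp_right _ (adj.counit.app S.X₃)
    exact bijAt_shift F hTS M (fun k hk => inj_ext _ _ _ hk) (fun k hk => inj_ext _ _ _ hk) n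
      (by lia) (bijAt_of_iso F b hT g n (by lia) (ih _ hV' n (by lia)))

include adj in
theorem bijAt_main (b : ℕ)
    (hT : ∀ K : A, IsZero (F.obj K) → ∀ (M : A) (k : ℕ), b < k → Subsingleton (Ext.{w1} M K k))
    (V : ℕ → B → Prop)
    (hV0 : ∀ S : ShortComplex B, S.ShortExact → Injective S.X₂ → V 0 S.X₁ →
      V 0 S.X₃ ∧ Epi (H.map S.g))
    (hV1 : ∀ d, ∀ S : ShortComplex B, S.ShortExact → Injective S.X₂ → V (d+1) S.X₁ →
      V d S.X₃)
    (c : ℕ) (hc : ∀ Y : B, V c Y) (M N : A) (n : ℕ) (hn : b + c + 1 < n) :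
    BijAt.{w1, w2} F M N n := by
  have : IsIso (F.map (adj.unit.app N)) := by
    have h := adj.left_triangle_components N
    have h2 : F.map (adj.unit.app N) = inv (adj.counit.app (F.obj N)) := by
      rw [← cancel_mono (adj.counit.app (F.obj N)), h]; simp
    rw [h2]; infer_instance
  exact bijAt_of_iso F b hT (adj.unit.app N) n (by lia)
    (bijAt_H F adj b hT V hV0 hV1 c _ (hc _) M n hn)

end AbsExt

section CornerFunctor

set_option linter.unusedVariables false

open CategoryTheory Limits Abelian

variable {Λ : Type u} [Ring Λ] (f : Λ) [hf : Fact (IsIdempotentElem f)]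

/-- The functor `M ↦ fM`. -/
def cF : ModuleCat.{u} Λ ⥤ ModuleCat.{u} (Corner f) where
  obj M := ModuleCat.of (Corner f) (CornerSub f M)
  map g := ModuleCat.ofHom (cornerMap f g.hom)
  map_id _ := rfl
  map_comp _ _ := rfl

instance : (cF f).Additive where
  map_add := rfl

theorem cF_exact (S : ShortComplex (ModuleCat.{u} Λ)) (hS : S.Exact) :
    (S.map (cF f)).Exact := by
  rw [ShortComplex.moduleCat_exact_iff] at hS ⊢
  intro x hx
  have hx' : S.g.hom x.1 = 0 := congrArg Subtype.val hx
  obtain ⟨y, hy⟩ := hS x.1 hx'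
  refine ⟨⟨f • y, ?_⟩, Subtype.ext ?_⟩
  · show f • f • y = f • y
    rw [smul_smul, hf.out]
  · show S.f.hom (f • y) = x.1
    rw [map_smul]
    have : S.f.hom y = x.1 := hy
    rw [this]
    exact x.2

instance : PreservesFiniteLimits (cF f) :=
  (((cF f).exact_tfae.out 1 3 rfl rfl).1 (cF_exact f)).1

instance : PreservesFiniteColimits (cF f) :=
  (((cF f).exact_tfae.out 1 3 rfl rfl).1 (cF_exact f)).2

/-- `Hom_{Λ*}(fΛ, Y)` -/
def HObj (Y : Type u) [AddCommGroup Y] [Module (Corner f) Y] : Type u :=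
  CornerSub f Λ →ₗ[Corner f] Y

/-- right multiplication on `fΛ` -/
def rmul (a : Λ) : CornerSub f Λ →ₗ[Corner f] CornerSub f Λ :=
  cornerMap f (LinearMap.toSpanSingleton Λ Λ a)

theorem rmul_val (a : Λ) (x : CornerSub f Λ) : (rmul f a x).1 = x.1 * a := rfl

section
variable (Y : Type u) [AddCommGroup Y] [Module (Corner f) Y]

instance : AddCommGroup (HObj f Y) :=
  inferInstanceAs (AddCommGroup (CornerSub f Λ →ₗ[Corner f] Y))

instance : SMul Λ (HObj f Y) :=
  ⟨fun a φ => (show CornerSub f Λ →ₗ[Corner f] Y from φ).comp (rmul f a)⟩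

instance : FunLike (HObj f Y) (CornerSub f Λ) Y :=
  inferInstanceAs (FunLike (CornerSub f Λ →ₗ[Corner f] Y) (CornerSub f Λ) Y)

variable {f Y}

theorem HObj.ext {φ ψ : HObj f Y} (h : ∀ x, φ x = ψ x) : φ = ψ := LinearMap.ext h

theorem HObj.smul_apply (a : Λ) (φ : HObj f Y) (x : CornerSub f Λ) :
    (a • φ) x = φ (rmul f a x) := rfl

theorem HObj.add_apply (φ ψ : HObj f Y) (x : CornerSub f Λ) : (φ + ψ) x = φ x + ψ x := rfl

theorem HObj.map_add (φ : HObj f Y) (x y : CornerSub f Λ) : φ (x + y) = φ x + φ y :=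
  LinearMap.map_add (show CornerSub f Λ →ₗ[Corner f] Y from φ) x y

theorem HObj.map_smul (φ : HObj f Y) (a : Corner f) (y : CornerSub f Λ) : φ (a • y) = a • φ y :=
  LinearMap.map_smul (show CornerSub f Λ →ₗ[Corner f] Y from φ) a y

theorem HObj.map_zero (φ : HObj f Y) : φ 0 = 0 :=
  LinearMap.map_zero (show CornerSub f Λ →ₗ[Corner f] Y from φ)

instance : Module Λ (HObj f Y) where
  one_smul φ := HObj.ext fun x => by
    rw [HObj.smul_apply]; congr 1; exact Subtype.ext (mul_one _)
  mul_smul a b φ := HObj.ext fun x => by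
    simp only [HObj.smul_apply]; congr 1; exact Subtype.ext (mul_assoc _ _ _).symm
  smul_add a φ ψ := rfl
  smul_zero a := rfl
  add_smul a b φ := HObj.ext fun x => by
    rw [HObj.add_apply]
    simp only [HObj.smul_apply]; rw [← HObj.map_add]; congr 1; exact Subtype.ext (mul_add _ _ _)
  zero_smul φ := HObj.ext fun x => by
    rw [HObj.smul_apply]
    have : rmul f 0 x = 0 := Subtype.ext (mul_zero _)
    rw [this, HObj.map_zero]; rfl

end

/-- functoriality of `HObj` -/
def HMap {Y Z : Type u} [AddCommGroup Y] [Module (Corner f) Y] [AddCommGroup Z]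
    [Module (Corner f) Z] (g : Y →ₗ[Corner f] Z) : HObj f Y →ₗ[Λ] HObj f Z where
  toFun φ := g.comp (show CornerSub f Λ →ₗ[Corner f] Y from φ)
  map_add' φ ψ := HObj.ext fun x => g.map_add _ _
  map_smul' a φ := rfl

/-- right adjoint of `cF` -/
def cH : ModuleCat.{u} (Corner f) ⥤ ModuleCat.{u} Λ where
  obj Y := ModuleCat.of Λ (HObj f Y)
  map g := ModuleCat.ofHom (HMap f g.hom)
  map_id _ := rfl
  map_comp _ _ := rfl

/-- action `fΛ × M → fM`. -/
def actM (M : Type u) [AddCommGroup M] [Module Λ M] (m : M) :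
    CornerSub f Λ →ₗ[Corner f] CornerSub f M :=
  cornerMap f (LinearMap.toSpanSingleton Λ M m)

/-- the element `f` of `fΛ`. -/
def fElt : CornerSub f Λ := ⟨f, hf.out⟩

/-- unit -/
def unitMap (M : Type u) [AddCommGroup M] [Module Λ M] : M →ₗ[Λ] HObj f (CornerSub f M) where
  toFun m := actM f M m
  map_add' m n := HObj.ext fun x => Subtype.ext (smul_add x.1 m n)
  map_smul' a m := HObj.ext fun x => Subtype.ext (smul_smul x.1 a m)

/-- counit -/
def counitMap (Y : Type u) [AddCommGroup Y] [Module (Corner f) Y] :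
    CornerSub f (HObj f Y) →ₗ[Corner f] Y where
  toFun φ := φ.1 (fElt f)
  map_add' φ ψ := rfl
  map_smul' a φ := by
    show (a.1 • φ.1) (fElt f) = a • φ.1 (fElt f)
    rw [HObj.smul_apply, ← HObj.map_smul]
    congr 1
    refine Subtype.ext ?_
    show f * a.1 = a.1 * f
    rw [Corner.absorb_left a.2, Corner.absorb_right a.2]

/-- right multiplication by `f`, `fΛ → fΛf`. -/
def rF : CornerSub f Λ →ₗ[Corner f] Corner f where
  toFun := fun x => ⟨x.1 * f, by
    show f * (x.1 * f) * f = x.1 * f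
    have h : f * x.1 = x.1 := x.2
    rw [← mul_assoc, h, mul_assoc, hf.out]⟩
  map_add' := fun x y => Subtype.ext (add_mul _ _ _)
  map_smul' := fun a x => Subtype.ext (mul_assoc _ _ _)

theorem counitMap_bij (Y : Type u) [AddCommGroup Y] [Module (Corner f) Y] :
    Function.Bijective (counitMap f Y) := by
  have key : ∀ (φ : CornerSub f (HObj f Y)) (x : CornerSub f Λ),
      φ.1 x = rF f x • φ.1 (fElt f) := by
    intro φ x
    have h : f • φ.1 = φ.1 := φ.2
    rw [← HObj.map_smul]
    conv_lhs => rw [← h, HObj.smul_apply]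
    congr 1
    refine Subtype.ext ?_
    show x.1 * f = x.1 * f * f
    rw [mul_assoc, hf.out]
  constructor
  · intro φ ψ h
    refine Subtype.ext (HObj.ext fun x => ?_)
    rw [key φ, key ψ]
    congr 1
  · intro y
    let φ : HObj f Y := show CornerSub f Λ →ₗ[Corner f] Y from
      (LinearMap.toSpanSingleton (Corner f) Y y).comp
      (rF f)
    refine ⟨⟨φ, ?_⟩, ?_⟩
    · refine HObj.ext fun x => ?_
      rw [HObj.smul_apply]
      refine congrArg (fun a : Corner f => a • y) (Subtype.ext ?_)
      show x.1 * f * f = x.1 * f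
      rw [mul_assoc, hf.out]
    · show (_ : Corner f) • y = y
      conv_rhs => rw [← one_smul (Corner f) y]
      refine congrArg (fun a : Corner f => a • y) (Subtype.ext ?_)
      exact hf.out

/-- the adjunction -/
def cAdj : cF f ⊣ cH f where
  unit := { app := fun M => ModuleCat.ofHom (unitMap f M)
            naturality := fun M N g => by
              ext m
              exact HObj.ext fun x => Subtype.ext (g.hom.map_smul x.1 m).symm }
  counit := { app := fun Y => ModuleCat.ofHom (counitMap f Y)
              naturality := fun Y Z g => rfl }
  left_triangle_components M := by
    ext m
    exact Subtype.ext m.2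
  right_triangle_components Y := by
    ext φ
    refine HObj.ext fun x => ?_
    refine congrArg (fun z => (show HObj f Y from φ) z) (Subtype.ext ?_ : _ = x)
    exact x.2

instance : IsIso (cAdj f).counit := by
  have : ∀ Y, IsIso ((cAdj f).counit.app Y) := fun Y =>
    (ConcreteCategory.isIso_iff_bijective _).2 (counitMap_bij f Y)
  exact NatIso.isIso_of_isIso_app _

end CornerFunctor

section Torsion

open CategoryTheory Limits Abelian

variable {Λ : Type u} [Ring Λ]

theorem ext_pi_subsingleton [HasExt.{u} (ModuleCat.{u} Λ)] (S : ModuleCat.{u} Λ) (I : Type u)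
    (k : ℕ) (M : ModuleCat.{u} Λ) (h : Subsingleton (Ext M S (k + 1))) :
    Subsingleton (Ext M (ModuleCat.of Λ (I → S)) (k + 1)) := by
  induction k generalizing M with
  | zero =>
    obtain ⟨p⟩ := EnoughProjectives.presentation M
    have hS : (ShortComplex.mk _ _ (kernel.condition p.f)).ShortExact :=
      { exact := ShortComplex.exact_kernel p.f }
    refine subsingleton_of_forall_eq 0 fun x => ?_
    obtain ⟨y, rfl⟩ := Ext.contravariant_sequence_exact₃ hS _ x
      (by apply Ext.eq_zero_of_projective) (rfl : 1 + 0 = 1)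
    obtain ⟨y, rfl⟩ := (Ext.mk₀_bijective _ _).2 y
    have key : ∀ i : I, ∃ z : p.p ⟶ S,
        kernel.ι p.f ≫ z = y ≫ ModuleCat.ofHom (LinearMap.proj i) := by
      intro i
      obtain ⟨z, hz⟩ := Ext.contravariant_sequence_exact₁ hS S
        (Ext.mk₀ (y ≫ ModuleCat.ofHom (LinearMap.proj i))) (rfl : 1 + 0 = 1) (h.elim _ _)
      obtain ⟨z, rfl⟩ := (Ext.mk₀_bijective _ _).2 z
      refine ⟨z, (Ext.mk₀_bijective _ _).1 ?_⟩
      rw [← hz, Ext.mk₀_comp_mk₀]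
    choose z hz using key
    have hy : y = kernel.ι p.f ≫ ModuleCat.ofHom (LinearMap.pi fun i => (z i).hom) := by
      ext t i
      exact (congrArg (fun q => q.hom t) (hz i)).symm
    rw [hy, ← Ext.mk₀_comp_mk₀]
    exact hS.extClass_comp_assoc _
  | succ k ih =>
    obtain ⟨p⟩ := EnoughProjectives.presentation M
    have hS : (ShortComplex.mk _ _ (kernel.condition p.f)).ShortExact :=
      { exact := ShortComplex.exact_kernel p.f }
    have h1 : Subsingleton (Ext (kernel p.f) S (k + 1)) := by
      refine subsingleton_of_forall_eq 0 fun y => ?_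
      obtain ⟨z, rfl⟩ := Ext.contravariant_sequence_exact₁ hS S y
        (by lia : 1 + (k + 1) = k + 1 + 1) (h.elim _ _)
      rw [Ext.eq_zero_of_projective z]
      simp
    have h2 := ih _ h1
    refine subsingleton_of_forall_eq 0 fun x => ?_
    obtain ⟨y, rfl⟩ := Ext.contravariant_sequence_exact₃ hS _ x
      (by apply Ext.eq_zero_of_projective) (by lia : 1 + (k + 1) = k + 1 + 1)
    have : y = 0 := h2.elim _ _
    rw [this]; simp

theorem ss_of_torsion [IsSemiprimaryRing Λ] (M : Type u) [AddCommGroup M] [Module Λ M]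
    (h : Module.IsTorsionBySet Λ M (Ring.jacobson Λ)) : IsSemisimpleModule Λ M := by
  let _ := h.module
  exact (h.semilinearMap.isSemisimpleModule_iff_of_bijective Function.bijective_id).2
      inferInstance

theorem injdim_semisimple [IsSemiprimaryRing Λ] (e : Λ) (n : ℕ)
    [HasExt.{u} (ModuleCat.{u} Λ)]
    (hid : ∀ (N : ModuleCat.{u} Λ) (k : ℕ), n < k → Subsingleton (Ext N (radQuotPart Λ e) k))
    (M : Type u) [AddCommGroup M] [Module Λ M]
    (h : Module.IsTorsionBySet Λ M (Ring.jacobson Λ)) (he : ∀ m : M, e • m = m) :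
    HasInjectiveDimensionLT (ModuleCat.of Λ M) (n + 1) := by
  have hr : jacRad Λ = Ring.jacobson Λ := Ideal.jacobson_bot
  let S : Submodule Λ (Λ ⧸ jacRad Λ) := Submodule.map (jacRad Λ).mkQ (lambdaE e)
  have hSt : ∀ (a : Λ), a ∈ Ring.jacobson Λ → ∀ s : S, a • s = 0 := by
    rintro a ha ⟨s, hs⟩
    obtain ⟨t, rfl⟩ := (jacRad Λ).mkQ_surjective s
    refine Subtype.ext ?_
    show a • (jacRad Λ).mkQ t = 0
    rw [← map_smul, Submodule.mkQ_apply, Submodule.Quotient.mk_eq_zero, hr]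
    exact Ideal.mul_mem_right _ _ ha
  have _ : IsSemisimpleModule Λ M := ss_of_torsion M h
  have _ : IsSemisimpleModule Λ (M → S) := ss_of_torsion _ (by
    rintro φ ⟨a, ha⟩
    funext m
    exact hSt a ha _)
  have _ : IsSemisimpleModule Λ (M →₀ S) := ss_of_torsion _ (by
    rintro φ ⟨a, ha⟩
    ext m : 1
    exact hSt a ha _)
  have hle : ∀ m : M, jacRad Λ ≤ LinearMap.ker (LinearMap.toSpanSingleton Λ M m) := by
    intro m a ha
    rw [hr] at ha
    exact @h m ⟨a, ha⟩
  let ev : M → (S →ₗ[Λ] M) := fun m =>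
    ((jacRad Λ).liftQ (LinearMap.toSpanSingleton Λ M m) (hle m)).comp S.subtype
  let E : (M →₀ S) →ₗ[Λ] M := Finsupp.lsum ℕ ev
  have hE : Function.Surjective E := by
    intro m
    refine ⟨Finsupp.single m ⟨(jacRad Λ).mkQ e, ⟨e, ⟨1, by simp⟩, rfl⟩⟩, ?_⟩
    simp only [E, Finsupp.lsum_single]
    exact he m
  obtain ⟨s, hs⟩ := IsSemisimpleModule.lifting_property (R := Λ) (M := M →₀ S) (N := M) (P := M) E hE LinearMap.id
  let J : (M →₀ S) →ₗ[Λ] (M → S) := Finsupp.lcoeFun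
  have hJ : Function.Injective J := DFunLike.coe_injective
  obtain ⟨t, ht⟩ := IsSemisimpleModule.extension_property (R := Λ) (M := M → S) (N := M →₀ S) (P := M →₀ S) J hJ LinearMap.id
  have ret : Retract (ModuleCat.of Λ M) (ModuleCat.of Λ (M → S)) :=
    { i := ModuleCat.ofHom (J.comp s)
      r := ModuleCat.ofHom (E.comp t)
      retract := by
        ext m
        have h1 : t (J (s m)) = s m := LinearMap.congr_fun ht (s m)
        have h2 : E (s m) = m := LinearMap.congr_fun hs m
        show E (t (J (s m))) = m
        rw [h1, h2] }
  have : HasInjectiveDimensionLT (ModuleCat.of Λ (M → S)) (n + 1) := by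
    rw [hasInjectiveDimensionLT_iff.{u}]
    intro i hi Y x
    obtain ⟨i, rfl⟩ : ∃ j, i = j + 1 := ⟨i - 1, by lia⟩
    exact (ext_pi_subsingleton (radQuotPart Λ e) M i Y (hid Y _ (by lia))).elim _ _
  exact ret.hasInjectiveDimensionLT (n + 1)

theorem injdim_torsion [IsSemiprimaryRing Λ] (e : Λ) (n : ℕ)
    [HasExt.{u} (ModuleCat.{u} Λ)]
    (hid : ∀ (N : ModuleCat.{u} Λ) (k : ℕ), n < k → Subsingleton (Ext N (radQuotPart Λ e) k))
    (M : Type u) [AddCommGroup M] [Module Λ M] (he : ∀ m : M, e • m = m) :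
    HasInjectiveDimensionLT (ModuleCat.of Λ M) (n + 1) := by
  revert he
  refine IsSemiprimaryRing.induction ℤ Λ M
    (P := fun M _ _ _ => (∀ m : M, e • m = m) →
      HasInjectiveDimensionLT (ModuleCat.of Λ M) (n + 1)) ?_ ?_
  · intro M _ _ _ _ _ h he
    exact injdim_semisimple e n hid M h he
  · intro M _ _ _ _ N h1 h2 he
    let S : ShortComplex (ModuleCat.{u} Λ) := ShortComplex.mk (ModuleCat.ofHom N.subtype)
      (ModuleCat.ofHom N.mkQ) (by ext x; simp)
    have hS : S.ShortExact :=
      { exact := by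
          rw [ShortComplex.moduleCat_exact_iff]
          intro x hx
          exact ⟨⟨x, (Submodule.Quotient.mk_eq_zero N).1 hx⟩, rfl⟩
        mono_f := (ModuleCat.mono_iff_injective _).2 N.subtype_injective
        epi_g := (ModuleCat.epi_iff_surjective _).2 N.mkQ_surjective }
    refine hS.hasInjectiveDimensionLT_X₂ (n + 1) (h1 ?_) (h2 ?_)
    · intro m; exact Subtype.ext (he m.1)
    · intro m
      obtain ⟨m, rfl⟩ := N.mkQ_surjective m
      rw [← map_smul, he]

end Torsion

section Final

open CategoryTheory Limits Abelian

variable {Λ : Type u} [Ring Λ]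

theorem V_step {R : Type u} [Ring R] [HasExt.{u} (ModuleCat.{u} R)] (Q : ModuleCat.{u} R)
    (d : ℕ) (S : ShortComplex (ModuleCat.{u} R)) (hS : S.ShortExact) (hJ : Injective S.X₂)
    (h : ∀ i, d + 1 < i → Subsingleton (Ext Q S.X₁ i)) (i : ℕ) (hi : d < i) :
    Subsingleton (Ext Q S.X₃ i) := by
  refine subsingleton_of_forall_eq 0 fun x => ?_
  obtain ⟨y, rfl⟩ := Ext.covariant_sequence_exact₃ Q hS x rfl
    ((h (i + 1) (by lia)).elim _ _)
  have := inj_ext.{u} Q S.X₂ i (by lia)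
  rw [Subsingleton.elim y 0]; simp

theorem H_epi (f : Λ) [hf : Fact (IsIdempotentElem f)] [HasExt.{u} (ModuleCat.{u} (Corner f))]
    (S : ShortComplex (ModuleCat.{u} (Corner f))) (hS : S.ShortExact)
    (h : Subsingleton (Ext ((cF f).obj (ModuleCat.of Λ Λ)) S.X₁ 1)) :
    Epi ((cH f).map S.g) := by
  refine (ModuleCat.epi_iff_surjective _).2 fun φ => ?_
  let g : (cF f).obj (ModuleCat.of Λ Λ) ⟶ S.X₃ :=
    ModuleCat.ofHom (show CornerSub f Λ →ₗ[Corner f] S.X₃ from φ)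
  obtain ⟨y, hy⟩ := Ext.covariant_sequence_exact₃ _ hS (Ext.mk₀ g) (zero_add 1) (h.elim _ _)
  obtain ⟨y, rfl⟩ := (Ext.mk₀_bijective _ _).2 y
  rw [Ext.mk₀_comp_mk₀] at hy
  have hy' := (Ext.mk₀_bijective _ _).1 hy
  exact ⟨y.hom, congrArg ModuleCat.Hom.hom hy'⟩

theorem pd_fLambda (e : Λ) [he : Fact (IsIdempotentElem e)]
    [HasExt.{u} (ModuleCat.{u} (Corner (1 - e)))] (c : ℕ)
    (hpdstar : ∀ (N : ModuleCat.{u} (Corner (1 - e))) (k : ℕ), c < k →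
      Subsingleton (Abelian.Ext
        (ModuleCat.of (Corner (1 - e)) (CornerSub (1 - e) ↥(lambdaE e))) N k))
    (Y : ModuleCat.{u} (Corner (1 - e))) (k : ℕ) (hk : c < k) :
    Subsingleton (Ext ((cF (1 - e)).obj (ModuleCat.of Λ Λ)) Y k) := by
  let p1 : (cF (1 - e)).obj (ModuleCat.of Λ Λ) ⟶
      ModuleCat.of (Corner (1 - e)) (CornerSub (1 - e) ↥(lambdaE e)) :=
    ModuleCat.ofHom (cornerMap (1 - e) (LinearMap.toSpanSingleton Λ Λ e).rangeRestrict)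
  let i1 : ModuleCat.of (Corner (1 - e)) (CornerSub (1 - e) ↥(lambdaE e)) ⟶
      (cF (1 - e)).obj (ModuleCat.of Λ Λ) :=
    ModuleCat.ofHom (cornerMap (1 - e) (lambdaE e).subtype)
  let p2 : (cF (1 - e)).obj (ModuleCat.of Λ Λ) ⟶
      ModuleCat.of (Corner (1 - e)) (Corner (1 - e)) := ModuleCat.ofHom (rF (1 - e))
  let i2' : Corner (1 - e) →ₗ[Corner (1 - e)] CornerSub (1 - e) Λ :=
    { toFun := fun x => ⟨x.1, Corner.absorb_left x.2⟩
      map_add' := fun _ _ => rfl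
      map_smul' := fun _ _ => rfl }
  let i2 : ModuleCat.of (Corner (1 - e)) (Corner (1 - e)) ⟶
      (cF (1 - e)).obj (ModuleCat.of Λ Λ) := ModuleCat.ofHom i2'
  have hid : p1 ≫ i1 + p2 ≫ i2 = 𝟙 _ := by
    ext x
    refine Subtype.ext ?_
    show x.1 * e + x.1 * (1 - e) = x.1
    rw [← mul_add]; simp
  have hproj : Projective (ModuleCat.of (Corner (1 - e)) (Corner (1 - e))) :=
    ModuleCat.projective_of_free (Module.Basis.singleton Unit (Corner (1 - e)))
  refine subsingleton_of_forall_eq 0 fun x => ?_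
  obtain ⟨k, rfl⟩ : ∃ j, k = j + 1 := ⟨k - 1, by lia⟩
  have h1 : (Ext.mk₀ i1).comp x (zero_add _) = 0 := (hpdstar Y _ hk).elim _ _
  have h2 : (Ext.mk₀ i2).comp x (zero_add _) = 0 := Ext.eq_zero_of_projective _
  have h3 : (Ext.mk₀ (p1 ≫ i1 + p2 ≫ i2)).comp x (zero_add _) = 0 := by
    rw [Ext.mk₀_add, Ext.add_comp, ← Ext.mk₀_comp_mk₀, ← Ext.mk₀_comp_mk₀,
      Ext.comp_assoc_of_second_deg_zero, Ext.comp_assoc_of_second_deg_zero, h1, h2]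
    simp
  rw [hid, Ext.mk₀_id_comp] at h3
  exact h3

theorem exists_theta (e : Λ) [he : Fact (IsIdempotentElem e)]
    (hsub : ∀ x : Λ, (1 - e) * x * e ∈ jacRad Λ) :
    Nonempty ((cF (1 - e)).obj (ModuleCat.of Λ (Λ ⧸ jacRad Λ)) ≅ starSemisimpleQuot (1 - e)) := by
  have hf : IsIdempotentElem (1 - e) := he.out.one_sub
  let g : Corner (1 - e) →ₗ[Corner (1 - e)] CornerSub (1 - e) (Λ ⧸ jacRad Λ) :=
    { toFun := fun x => ⟨(jacRad Λ).mkQ x.1, by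
        show (1 - e) • (jacRad Λ).mkQ x.1 = (jacRad Λ).mkQ x.1
        rw [← map_smul]
        exact congrArg _ (Corner.absorb_left x.2)⟩
      map_add' := fun _ _ => rfl
      map_smul' := fun _ _ => rfl }
  have hg0 : ∀ x : Corner (1 - e), g x = 0 ↔ x ∈ rStar (1 - e) := by
    intro x
    constructor
    · intro h
      exact (Submodule.Quotient.mk_eq_zero (jacRad Λ)).1 (congrArg Subtype.val h)
    · intro h
      exact Subtype.ext ((Submodule.Quotient.mk_eq_zero (jacRad Λ)).2 h)
  have hker : LinearMap.ker g = rStar (1 - e) := by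
    ext x
    exact hg0 x
  have hsurj : Function.Surjective g := by
    rintro ⟨m, hm⟩
    have hm : (1 - e) • m = m := hm
    obtain ⟨t, rfl⟩ := (jacRad Λ).mkQ_surjective m
    refine ⟨⟨(1 - e) * t * (1 - e), ?_⟩, Subtype.ext ?_⟩
    · show (1 - e) * ((1 - e) * t * (1 - e)) * (1 - e) = (1 - e) * t * (1 - e)
      rw [mul_assoc (1 - e) t, ← mul_assoc (1 - e) (1 - e), hf, mul_assoc, mul_assoc t, hf]
    · show (jacRad Λ).mkQ ((1 - e) * t * (1 - e)) = (jacRad Λ).mkQ t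
      rw [mul_sub, map_sub, mul_one]
      have h0 : (jacRad Λ).mkQ ((1 - e) * t * e) = 0 :=
        (Submodule.Quotient.mk_eq_zero (jacRad Λ)).2 (hsub t)
      rw [h0, sub_zero]
      exact hm
  let E : (Corner (1 - e) ⧸ rStar (1 - e)) ≃ₗ[Corner (1 - e)]
      CornerSub (1 - e) (Λ ⧸ jacRad Λ) :=
    (Submodule.quotEquivOfEq _ _ hker.symm).trans (g.quotKerEquivOfSurjective hsurj)
  exact ⟨E.symm.toModuleIso⟩

/-- conjugation by an isomorphism -/
noncomputable def conjExt {R : Type u} [Ring R] [HasExt.{u} (ModuleCat.{u} R)]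
    {X Y : ModuleCat.{u} R}
    (θ : X ≅ Y) (n : ℕ) : Ext X X n ≃+ Ext Y Y n where
  toFun x := (Ext.mk₀ θ.inv).comp (x.comp (Ext.mk₀ θ.hom) (add_zero n)) (zero_add n)
  invFun x := (Ext.mk₀ θ.hom).comp (x.comp (Ext.mk₀ θ.inv) (add_zero n)) (zero_add n)
  left_inv x := by simp
  right_inv x := by simp
  map_add' x y := by simp

theorem conjExt_comp {R : Type u} [Ring R] [HasExt.{u} (ModuleCat.{u} R)]
    {X Y : ModuleCat.{u} R} (θ : X ≅ Y) (m n : ℕ) (x : Ext X X m) (y : Ext X X n) :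
    conjExt θ (m + n) (x.comp y rfl) = (conjExt θ m x).comp (conjExt θ n y) rfl := by
  have h : ((Ext.mk₀ θ.hom).comp ((Ext.mk₀ θ.inv).comp
      (y.comp (Ext.mk₀ θ.hom) (add_zero n)) (zero_add n)) (zero_add n)) =
      y.comp (Ext.mk₀ θ.hom) (add_zero n) := by simp
  show (Ext.mk₀ θ.inv).comp ((x.comp y rfl).comp (Ext.mk₀ θ.hom) (add_zero _)) (zero_add _) =
    ((Ext.mk₀ θ.inv).comp (x.comp (Ext.mk₀ θ.hom) (add_zero m)) (zero_add m)).comp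
      ((Ext.mk₀ θ.inv).comp (y.comp (Ext.mk₀ θ.hom) (add_zero n)) (zero_add n)) rfl
  rw [Ext.comp_assoc (Ext.mk₀ θ.inv) _ _ (zero_add m) (rfl : m + n = m + n) (by lia),
    Ext.comp_assoc_of_second_deg_zero, h, Ext.comp_assoc_of_third_deg_zero]

end Final

theorem cohomology_ring_comparison
    {Λ : Type u} [Ring Λ]
    (C : Type u) [CommRing C] [IsArtinianRing C] [Algebra C Λ] [Module.Finite C Λ]
    (e : Λ) [he : Fact (IsIdempotentElem e)]
    [HasExt.{u} (ModuleCat.{u} Λ)] [HasExt.{u} (ModuleCat.{u} (Corner (1 - e)))]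
    (hsub : ∀ x : Λ, (1 - e) * x * e ∈ jacRad Λ)
    (a b c : ℕ)
    (hpdstar : ∀ (N : ModuleCat.{u} (Corner (1 - e))) (k : ℕ), c < k →
      Subsingleton (Abelian.Ext
        (ModuleCat.of (Corner (1 - e)) (CornerSub (1 - e) ↥(lambdaE e))) N k))
    (hpd : ∀ (N : ModuleCat.{u} Λ) (k : ℕ), a < k →
      Subsingleton (Abelian.Ext (radQuotPart Λ e) N k))
    (hid : ∀ (N : ModuleCat.{u} Λ) (k : ℕ), b < k →
      Subsingleton (Abelian.Ext N (radQuotPart Λ e) k)) :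
    ∃ φ : ∀ n : ℕ, max a (b + c + 2) < n →
        (Abelian.Ext (ModuleCat.of Λ (Λ ⧸ jacRad Λ)) (ModuleCat.of Λ (Λ ⧸ jacRad Λ)) n ≃+
          Abelian.Ext (starSemisimpleQuot (1 - e)) (starSemisimpleQuot (1 - e)) n),
      ∀ (n₁ n₂ : ℕ) (h₁ : max a (b + c + 2) < n₁) (h₂ : max a (b + c + 2) < n₂)
        (α : Abelian.Ext (ModuleCat.of Λ (Λ ⧸ jacRad Λ)) (ModuleCat.of Λ (Λ ⧸ jacRad Λ)) n₁)
        (β : Abelian.Ext (ModuleCat.of Λ (Λ ⧸ jacRad Λ)) (ModuleCat.of Λ (Λ ⧸ jacRad Λ)) n₂),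
        φ (n₁ + n₂) (lt_of_lt_of_le h₁ (Nat.le_add_right n₁ n₂)) (α.comp β rfl) =
          (φ n₁ h₁ α).comp (φ n₂ h₂ β) rfl := by
  have hart : IsArtinianRing Λ := IsArtinianRing.of_finite C Λ
  have hT : ∀ K : ModuleCat.{u} Λ, Limits.IsZero ((cF (1 - e)).obj K) →
      ∀ (M : ModuleCat.{u} Λ) (k : ℕ), b < k → Subsingleton (Abelian.Ext.{u} M K k) := by
    intro K hK M k hk
    have hsub0 : Subsingleton (CornerSub (1 - e) K) := ModuleCat.subsingleton_of_isZero hK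
    have hK' : ∀ m : K, e • m = m := by
      intro m
      have h0 : (⟨(1 - e) • m, by
          show (1 - e) • (1 - e) • m = (1 - e) • m
          rw [smul_smul, he.out.one_sub]⟩ : CornerSub (1 - e) K) = 0 := hsub0.elim _ _
      have h1 : (1 - e) • m = 0 := congrArg Subtype.val h0
      rw [sub_smul, one_smul, sub_eq_zero] at h1
      exact h1.symm
    have := injdim_torsion e b hid K hK'
    exact HasInjectiveDimensionLT.subsingleton K (b + 1) k hk M
  have hbij : ∀ n, b + c + 1 < n → BijAt.{u, u} (cF (1 - e)) (ModuleCat.of Λ (Λ ⧸ jacRad Λ))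
      (ModuleCat.of Λ (Λ ⧸ jacRad Λ)) n := fun n hn =>
    bijAt_main (cF (1 - e)) (cAdj (1 - e)) b hT
      (fun d Y => ∀ i, d < i → Subsingleton
        (Abelian.Ext ((cF (1 - e)).obj (ModuleCat.of Λ Λ)) Y i))
      (fun S hS hJ h => ⟨V_step _ 0 S hS hJ (fun i hi => h i (by lia)),
        H_epi (1 - e) S hS (h 1 one_pos)⟩)
      (fun d S hS hJ h => V_step _ d S hS hJ h)
      c (fun Y k hk => pd_fLambda e c hpdstar Y k hk) _ _ n hn
  obtain ⟨θ⟩ := exists_theta e hsub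
  refine ⟨fun n hn => (AddEquiv.ofBijective ((cF (1 - e)).mapExtAddHom _ _ n)
    (hbij n (by have := (max_lt_iff.1 hn).2; lia))).trans (conjExt θ n), ?_⟩
  intro n₁ n₂ h₁ h₂ α β
  show conjExt θ (n₁ + n₂) ((α.comp β rfl).mapExactFunctor (cF (1 - e))) =
    (conjExt θ n₁ (α.mapExactFunctor (cF (1 - e)))).comp
      (conjExt θ n₂ (β.mapExactFunctor (cF (1 - e)))) rfl
  rw [Abelian.Ext.mapExactFunctor_comp, conjExt_comp]
end
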